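/- Fix an integer N ≥ 2 and parameters (z̄_2, …, z̄_N) ∈ ℝ^{N−1} parameterizing the gauge field functions near the origin. Then there exists Λ_0 < 0 such that for every Λ < Λ_0 there exists a soliton solution of the su(N) EYM field equations with cosmological constant Λ, defined on [0, ∞), regular at the origin with origin expansion parameters (z̄_2, …, z̄_N), with μ > 0 on (0, ∞), satisfying the boundary conditions at infinity, and such that every gauge field function ω_j has no zeros on [0, ∞). -/

import Mathlib

open Filter Asymptotics Topology

noncomputable section

/-- μ(r) = 1 − 2m(r)/r − Λr²/3. -/
def muF (Λ : ℝ) (m : ℝ → ℝ) (r : ℝ) : ℝ := 1 - 2 * m r / r - Λ * r ^ 2 / 3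

/-- G = Σ_{j=1}^{N−1} (ω_j′)². -/
def GF (N : ℕ) (ω : ℕ → ℝ → ℝ) (r : ℝ) : ℝ :=
  ∑ j ∈ Finset.Icc 1 (N - 1), deriv (ω j) r ^ 2

/-- p_θ evaluated on a set of gauge-field values `w`. -/
def pThetaVal (N : ℕ) (w : ℕ → ℝ) (r : ℝ) : ℝ :=
  1 / (4 * r ^ 4) *
    ∑ j ∈ Finset.Icc 1 N, (w j ^ 2 - w (j - 1) ^ 2 - (N : ℝ) - 1 + 2 * (j : ℝ)) ^ 2

/-- p_θ = (1/4r⁴) Σ_{j=1}^{N} (ω_j² − ω_{j−1}² − N − 1 + 2j)². -/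
def pTheta (N : ℕ) (ω : ℕ → ℝ → ℝ) (r : ℝ) : ℝ := pThetaVal N (fun j => ω j r) r

/-- W_j evaluated on gauge-field values `w`. -/
def WVal (w : ℕ → ℝ) (j : ℕ) : ℝ :=
  1 - w j ^ 2 + 1 / 2 * (w (j - 1) ^ 2 + w (j + 1) ^ 2)

/-- W_j = 1 − ω_j² + (1/2)(ω_{j−1}² + ω_{j+1}²). -/
def WF (ω : ℕ → ℝ → ℝ) (j : ℕ) (r : ℝ) : ℝ := WVal (fun i => ω i r) j

/-- The static spherically symmetric su(N) EYM field equations at radius `r`: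
m′ = μG + r²p_θ, S′ = S·(2G/r), and the N−1 Yang–Mills equations
r²μω_j″ + (2m − 2r³p_θ − (2Λ/3)r³)ω_j′ + W_jω_j = 0, with ω₀ ≡ 0, ω_N ≡ 0. -/
def EYM (N : ℕ) (Λ : ℝ) (m S : ℝ → ℝ) (ω : ℕ → ℝ → ℝ) (r : ℝ) : Prop :=
  ω 0 r = 0 ∧ ω N r = 0 ∧
  HasDerivAt m (muF Λ m r * GF N ω r + r ^ 2 * pTheta N ω r) r ∧
  HasDerivAt S (S r * (2 * GF N ω r / r)) r ∧
  ∀ j ∈ Finset.Icc 1 (N - 1),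
    DifferentiableAt ℝ (ω j) r ∧ DifferentiableAt ℝ (deriv (ω j)) r ∧
    r ^ 2 * muF Λ m r * deriv (deriv (ω j)) r
      + (2 * m r - 2 * r ^ 3 * pTheta N ω r - 2 * Λ * r ^ 3 / 3) * deriv (ω j) r
      + WF ω j r * ω j r = 0

/-- Boundary conditions at infinity: m → M, S → 1, ω_j → ω_{j,∞} as r → ∞. -/
def BCInfinity (N : ℕ) (m S : ℝ → ℝ) (ω : ℕ → ℝ → ℝ) : Prop :=
  (∃ M : ℝ, Tendsto m atTop (𝓝 M)) ∧ Tendsto S atTop (𝓝 1) ∧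
  ∀ j ∈ Finset.Icc 1 (N - 1), ∃ w : ℝ, Tendsto (ω j) atTop (𝓝 w)

/-- `f` has exactly `k` zeros in the set `s`. -/
def HasExactlyZeros (f : ℝ → ℝ) (s : Set ℝ) (k : ℕ) : Prop :=
  {r ∈ s | f r = 0}.Finite ∧ {r ∈ s | f r = 0}.ncard = k

/-- The (N−1)×(N−1) matrix A (with 1-based index jᵥ = j+1):
A_{i,j} = 2jᵥ(N−jᵥ) if i = j, −jᵥ(N−jᵥ) if |i−j| = 1, 0 otherwise. -/
def matA (N : ℕ) : Matrix (Fin (N - 1)) (Fin (N - 1)) ℝ :=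
  Matrix.of fun i j =>
    if i = j then 2 * (((j : ℕ) + 1 : ℝ) * ((N : ℝ) - ((j : ℕ) + 1)))
    else if (i : ℕ) + 1 = (j : ℕ) ∨ (j : ℕ) + 1 = (i : ℕ) then
      -(((j : ℕ) + 1 : ℝ) * ((N : ℝ) - ((j : ℕ) + 1)))
    else 0

/-- A choice of nonzero eigenvectors v_k of A with eigenvalue k(k−1), where k = i+2. -/
def IsEigenBasis (N : ℕ) (v : Fin (N - 1) → Fin (N - 1) → ℝ) : Prop :=
  ∀ i : Fin (N - 1), v i ≠ 0 ∧
    (matA N).mulVec (v i) = ((((i : ℕ) + 2) * ((i : ℕ) + 1) : ℕ) : ℝ) • v i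

/-- Regularity at the origin with expansion parameters z̄: m(r) = O(r³), S(0) > 0, and
u_j(r) = ω_j(r)/√(j(N−j)) = 1 + Σ_{k=2}^{N} ζ_k(r) (v_k)_j r^k near r = 0, with ζ_k
analytic at 0 and ζ_k(0) = z̄_k (here k = i+2 for i : Fin (N−1)). -/
def RegularOrigin (N : ℕ) (v : Fin (N - 1) → Fin (N - 1) → ℝ)
    (m S : ℝ → ℝ) (ω : ℕ → ℝ → ℝ) (z : Fin (N - 1) → ℝ) : Prop :=
  (m =O[𝓝[>] (0 : ℝ)] fun r => r ^ 3) ∧ 0 < S 0 ∧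
  ∃ δ > 0, ∃ ζ : Fin (N - 1) → ℝ → ℝ,
    (∀ i, AnalyticAt ℝ (ζ i) 0 ∧ ζ i 0 = z i) ∧
    ∀ j : Fin (N - 1), ∀ r ∈ Set.Ioo (0 : ℝ) δ,
      ω ((j : ℕ) + 1) r
        = Real.sqrt (((j : ℕ) + 1 : ℝ) * ((N : ℝ) - ((j : ℕ) + 1)))
          * (1 + ∑ i : Fin (N - 1), ζ i r * v i j * r ^ ((i : ℕ) + 2))

theorem PowerSeries.coeff_mul_mul_pow (p q : PowerSeries ℝ) (n : ℕ) (t : ℝ) :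
    PowerSeries.coeff n (p * q) * t ^ n
      = ∑ k ∈ Finset.HasAntidiagonal.antidiagonal n,
          (PowerSeries.coeff k.1 p * t ^ k.1) * (PowerSeries.coeff k.2 q * t ^ k.2) := by
  rw [PowerSeries.coeff_mul, Finset.sum_mul]
  refine Finset.sum_congr rfl fun k hk => ?_
  rw [← Finset.HasAntidiagonal.mem_antidiagonal.1 hk, pow_add]
  ring

/-- Real power series converging absolutely on the closed disc of radius `2`. -/
def discSubalgebra : Subalgebra ℝ (PowerSeries ℝ) where
  carrier := {p | Summable fun n => ‖PowerSeries.coeff n p * 2 ^ n‖}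
  mul_mem' {p q} hp hq := by
    simpa only [Set.mem_ofPred_eq, PowerSeries.coeff_mul_mul_pow] using
      summable_norm_sum_mul_antidiagonal_of_summable_norm hp hq
  add_mem' {p q} hp hq := by
    refine Summable.of_nonneg_of_le (fun _ => norm_nonneg _) (fun n => ?_) (hp.add hq)
    rw [map_add, add_mul]
    exact norm_add_le _ _
  algebraMap_mem' c := by
    refine summable_of_ne_finset_zero (s := {0}) fun n hn => ?_
    rw [PowerSeries.algebraMap_apply, PowerSeries.coeff_C, if_neg (by simpa using hn)]
    simp

/-- The Banach algebra of real power series converging absolutely on the closed disc of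
radius `2`. -/
abbrev DiscSeries : Type := discSubalgebra

namespace DiscSeries

/-- The `n`-th coefficient. -/
def coeff (f : DiscSeries) (n : ℕ) : ℝ := PowerSeries.coeff n (f : PowerSeries ℝ)

theorem coeff_add (f g : DiscSeries) (n : ℕ) : (f + g).coeff n = f.coeff n + g.coeff n := by
  simp [coeff]

theorem coeff_smul (c : ℝ) (f : DiscSeries) (n : ℕ) : (c • f).coeff n = c * f.coeff n := by
  simp [coeff]

theorem ext_coeff {f g : DiscSeries} (h : ∀ n, f.coeff n = g.coeff n) : f = g :=
  Subtype.ext (PowerSeries.ext h)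

theorem summable_coeff (f : DiscSeries) : Summable fun n => ‖f.coeff n * 2 ^ n‖ := f.2

/-- The element with given coefficients. -/
def ofCoeff (a : ℕ → ℝ) (ha : Summable fun n => ‖a n * 2 ^ n‖) : DiscSeries :=
  ⟨PowerSeries.mk a, by simpa [discSubalgebra] using ha⟩

@[simp] theorem coeff_ofCoeff (a : ℕ → ℝ) (ha) (n : ℕ) : (ofCoeff a ha).coeff n = a n := by
  simp [ofCoeff, coeff]

theorem coeff_mul_mul_pow (f g : DiscSeries) (n : ℕ) (t : ℝ) :
    (f * g).coeff n * t ^ n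
      = ∑ k ∈ Finset.HasAntidiagonal.antidiagonal n,
          (f.coeff k.1 * t ^ k.1) * (g.coeff k.2 * t ^ k.2) :=
  PowerSeries.coeff_mul_mul_pow _ _ n t

/-- The weighted `ℓ¹` norm. -/
def ringNorm : RingNorm DiscSeries where
  toFun f := ∑' n, ‖f.coeff n * 2 ^ n‖
  map_zero' := by simp [coeff]
  add_le' f g := by
    rw [← f.summable_coeff.tsum_add g.summable_coeff]
    refine (f + g).summable_coeff.tsum_le_tsum (fun n => ?_)
      (f.summable_coeff.add g.summable_coeff)
    rw [coeff_add, add_mul]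
    exact norm_add_le _ _
  neg' f := by simp [coeff]
  mul_le' f g := by
    rw [tsum_mul_tsum_eq_tsum_sum_antidiagonal_of_summable_norm
      (by simpa using f.summable_coeff) (by simpa using g.summable_coeff)]
    refine (f * g).summable_coeff.tsum_le_tsum (fun n => ?_) ?_
    · rw [coeff_mul_mul_pow]
      refine (norm_sum_le _ _).trans (Finset.sum_le_sum fun k _ => ?_)
      exact norm_mul_le _ _
    · simpa using (summable_norm_sum_mul_antidiagonal_of_summable_norm
        (f := fun n => ‖f.coeff n * 2 ^ n‖) (g := fun n => ‖g.coeff n * 2 ^ n‖)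
        (by simpa using f.summable_coeff) (by simpa using g.summable_coeff)).of_norm
  eq_zero_of_map_eq_zero' f hf := by
    refine ext_coeff fun n => ?_
    have h := (hasSum_zero_iff_of_nonneg fun n => norm_nonneg (f.coeff n * 2 ^ n)).1
      (hf ▸ f.summable_coeff.hasSum)
    simpa [coeff] using congrFun h n

instance : NormedCommRing DiscSeries where
  __ := ringNorm.toNormedRing
  mul_comm := mul_comm

theorem norm_def (f : DiscSeries) : ‖f‖ = ∑' n, ‖f.coeff n * 2 ^ n‖ := rfl

instance : NormedAlgebra ℝ DiscSeries where
  norm_smul_le c f := by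
    simp only [norm_def, coeff_smul, mul_assoc, norm_mul]
    rw [tsum_mul_left]

instance : CompleteSpace DiscSeries := by
  have hmem : ∀ f : DiscSeries, Memℓp (fun n => f.coeff n * 2 ^ n) 1 := fun f => by
    rw [memℓp_gen_iff (by simp)]
    simpa using f.summable_coeff
  let e : DiscSeries → lp (fun _ : ℕ => ℝ) 1 := fun f => ⟨fun n => f.coeff n * 2 ^ n, hmem f⟩
  have he : Isometry e := by
    refine Isometry.of_dist_eq fun f g => ?_
    rw [dist_eq_norm, dist_eq_norm, lp.norm_eq_tsum_rpow (by simp), norm_def]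
    have h : ∀ n, (e f - e g) n = (f - g).coeff n * 2 ^ n := fun n => by
      show f.coeff n * 2 ^ n - g.coeff n * 2 ^ n = _
      simp [coeff, sub_mul]
    simp [h]
  have hs : Function.Surjective e := fun x => by
    have hx : Summable fun n => ‖x n / 2 ^ n * 2 ^ n‖ := by
      have := (memℓp_gen_iff (p := 1) (by simp)).1 x.2
      simpa using this
    exact ⟨ofCoeff (fun n => x n / 2 ^ n) hx, by ext n; simp [e]⟩
  exact (he.isUniformInducing.completeSpace_congr hs).2 inferInstance

/-- Value of the series at `t`. -/
def ev (f : DiscSeries) (t : ℝ) : ℝ := ∑' n, f.coeff n * t ^ n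

theorem norm_term_le (f : DiscSeries) {t : ℝ} (ht : |t| ≤ 2) (n : ℕ) :
    ‖f.coeff n * t ^ n‖ ≤ ‖f.coeff n * 2 ^ n‖ := by
  simp only [norm_mul, norm_pow, Real.norm_eq_abs, abs_two]
  gcongr

theorem summable_norm_term (f : DiscSeries) {t : ℝ} (ht : |t| ≤ 2) :
    Summable fun n => ‖f.coeff n * t ^ n‖ :=
  f.summable_coeff.of_nonneg_of_le (fun _ => norm_nonneg _) (f.norm_term_le ht)

/-- Evaluation at a point of the disc as an algebra homomorphism. -/
def evHom (t : ℝ) (ht : |t| ≤ 2) : DiscSeries →ₐ[ℝ] ℝ :=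
  AlgHom.ofLinearMap
    { toFun := fun f => f.ev t
      map_add' := fun f g => by
        simp only [ev, coeff_add, add_mul]
        exact (f.summable_norm_term ht).of_norm.tsum_add (g.summable_norm_term ht).of_norm
      map_smul' := fun c f => by
        simp only [ev, coeff_smul, mul_assoc, tsum_mul_left]
        simp }
    (by
      show ∑' n, (1 : DiscSeries).coeff n * t ^ n = 1
      rw [tsum_eq_single 0 (fun n hn => by simp [coeff, PowerSeries.coeff_one, hn])]
      simp [coeff])
    (fun f g => by
      show (f * g).ev t = f.ev t * g.ev t
      simp only [ev, coeff_mul_mul_pow]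
      exact (tsum_mul_tsum_eq_tsum_sum_antidiagonal_of_summable_norm
        (f.summable_norm_term ht) (g.summable_norm_term ht)).symm)

theorem evHom_apply (t : ℝ) (ht : |t| ≤ 2) (f : DiscSeries) : evHom t ht f = f.ev t := rfl

theorem abs_ev_le (f : DiscSeries) {t : ℝ} (ht : |t| ≤ 2) : |f.ev t| ≤ ‖f‖ := by
  rw [norm_def]
  exact (norm_tsum_le_tsum_norm (f.summable_norm_term ht)).trans
    ((f.summable_norm_term ht).tsum_le_tsum (f.norm_term_le ht) f.summable_coeff)

theorem continuousOn_ev (f : DiscSeries) : ContinuousOn f.ev (Set.Icc (-2) 2) :=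
  continuousOn_tsum (fun n => by fun_prop) f.summable_coeff
    fun n t ht => f.norm_term_le (abs_le.2 ht) n

theorem analyticAt_ev (f : DiscSeries) : AnalyticAt ℝ f.ev 0 := by
  let p := FormalMultilinearSeries.ofScalars ℝ f.coeff
  have hr : (2 : NNReal) ≤ p.radius := by
    refine p.le_radius_of_summable_norm ?_
    simpa [p, FormalMultilinearSeries.ofScalars_norm] using f.summable_coeff
  have h := (p.hasFPowerSeriesOnBall (lt_of_lt_of_le (by norm_num) hr)).analyticAt
  refine h.congr (Filter.Eventually.of_forall fun t => ?_)
  simp [p, FormalMultilinearSeries.sum, ev, mul_comm]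

/-- The variable. -/
def X : DiscSeries := ofCoeff (fun n => if n = 1 then 1 else 0)
  (summable_of_ne_finset_zero (s := {1}) fun n hn => by simp [show n ≠ 1 by simpa using hn])

@[simp] theorem ev_X (t : ℝ) : X.ev t = t := by
  rw [ev, tsum_eq_single 1 (fun n hn => by simp [X, hn])]
  simp [X]

/-- The averaging operator `f ↦ t ^ (-p-1) ∫₀ᵗ s ^ p f(s) ds`. -/
def avg (p : ℕ) : DiscSeries →L[ℝ] DiscSeries :=
  LinearMap.mkContinuous
    { toFun := fun f => ofCoeff (fun n => f.coeff n / (n + p + 1)) (by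
        refine f.summable_coeff.of_nonneg_of_le (fun _ => norm_nonneg _) fun n => ?_
        rw [norm_mul, norm_mul, norm_div]
        gcongr
        refine div_le_self (norm_nonneg _) ?_
        rw [Real.norm_of_nonneg (by positivity)]
        linarith [(Nat.cast_nonneg n : (0:ℝ) ≤ n), (Nat.cast_nonneg p : (0:ℝ) ≤ p)])
      map_add' := fun f g => ext_coeff fun n => by simp [coeff_add, add_div]
      map_smul' := fun c f => ext_coeff fun n => by simp [coeff_smul, mul_div_assoc] }
    1 (fun f => by
      rw [one_mul, norm_def, norm_def]
      refine Summable.tsum_le_tsum (fun n => ?_) (summable_coeff _) (summable_coeff _)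
      simp only [LinearMap.coe_mk, AddHom.coe_mk, coeff_ofCoeff]
      rw [norm_mul, norm_mul, norm_div]
      gcongr
      refine div_le_self (norm_nonneg _) ?_
      rw [Real.norm_of_nonneg (by positivity)]
      linarith [(Nat.cast_nonneg n : (0:ℝ) ≤ n), (Nat.cast_nonneg p : (0:ℝ) ≤ p)])

@[simp] theorem coeff_avg (p : ℕ) (f : DiscSeries) (n : ℕ) :
    (avg p f).coeff n = f.coeff n / (n + p + 1) := by
  simp [avg]

theorem hasDerivAt_pow_mul_ev_avg (p : ℕ) (f : DiscSeries) {t : ℝ} (ht : |t| < 2) :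
    HasDerivAt (fun s => s ^ (p + 1) * (avg p f).ev s) (t ^ p * f.ev t) t := by
  have key := hasDerivAt_tsum_of_isPreconnected (𝕜 := ℝ)
    (g := fun n s => s ^ (p + 1) * ((avg p f).coeff n * s ^ n))
    (g' := fun n s => s ^ p * (f.coeff n * s ^ n))
    (u := fun n => 2 ^ p * ‖f.coeff n * 2 ^ n‖) (t := Set.Ioo (-2) 2) (y₀ := 0) (y := t)
    (f.summable_coeff.mul_left _) isOpen_Ioo isPreconnected_Ioo
    (fun n s _ => by
      have h := (hasDerivAt_pow (n + p + 1) s).const_mul (f.coeff n / (n + p + 1))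
      have hn : (n + p + 1 : ℝ) ≠ 0 := by positivity
      rw [Nat.add_sub_cancel, Nat.cast_add, Nat.cast_add, Nat.cast_one, ← mul_assoc,
        div_mul_cancel₀ _ hn] at h
      convert! h using 1
      · funext s
        rw [coeff_avg]
        ring
      · ring)
    (fun n s hs => by
      have hs' : |s| ≤ 2 := (abs_lt.2 hs).le
      rw [norm_mul, norm_pow]
      gcongr
      · exact hs'
      · exact f.norm_term_le hs' n)
    (by simp) (by simp [summable_zero]) (abs_lt.1 ht)
  simp only [tsum_mul_left] at key
  exact key

end DiscSeries

namespace DiscSeries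

theorem exists_ev_eq_re {F : ℂ → ℂ} (hF : DifferentiableOn ℂ F (Metric.ball 0 3)) :
    ∃ e : DiscSeries, ∀ t : ℝ, |t| ≤ 2 → e.ev t = (F t).re := by
  have hp := (hF.mono (Metric.closedBall_subset_ball (by norm_num))).hasFPowerSeriesOnBall
    (R := 5 / 2) (c := 0) (by norm_num)
  set p := cauchyPowerSeries F 0 ((5 / 2 : NNReal) : ℝ) with hpdef
  have hs : Summable fun n => ‖p n‖ * ((2 : NNReal) : ℝ) ^ n := by
    refine p.summable_norm_mul_pow (lt_of_lt_of_le ?_ hp.r_le)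
    rw [ENNReal.coe_lt_coe, ← NNReal.coe_lt_coe]
    norm_num
  refine ⟨ofCoeff (fun n => (p.coeff n).re) (hs.of_nonneg_of_le (fun _ => norm_nonneg _)
    fun n => ?_), fun t ht => ?_⟩
  · rw [norm_mul, norm_pow]
    simp only [Real.norm_eq_abs, abs_two, NNReal.coe_ofNat]
    gcongr
    exact (Complex.abs_re_le_norm _).trans p.norm_apply_eq_norm_coef.ge
  · have h := hp.hasSum (y := (t : ℂ)) (by
      rw [Metric.mem_eball, edist_zero_right, ← ofReal_norm]
      rw [Complex.norm_real, Real.norm_eq_abs]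
      rw [ENNReal.ofReal_lt_iff_lt_toReal (abs_nonneg _) ENNReal.coe_ne_top]
      simp only [ENNReal.coe_toReal, NNReal.coe_div, NNReal.coe_ofNat]
      linarith)
    have h' := Complex.hasSum_re h
    rw [zero_add] at h'
    rw [ev, ← h'.tsum_eq]
    refine tsum_congr fun n => ?_
    rw [coeff_ofCoeff, p.apply_eq_pow_smul_coeff, smul_eq_mul, ← Complex.ofReal_pow,
      Complex.re_ofReal_mul, mul_comm]

theorem exists_ev_eq_cos : ∃ c : DiscSeries, ∀ t : ℝ, |t| ≤ 2 → c.ev t = Real.cos t := by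
  obtain ⟨e, he⟩ := exists_ev_eq_re (F := Complex.cos) Complex.differentiable_cos.differentiableOn
  exact ⟨e, fun t ht => by rw [he t ht, Complex.cos_ofReal_re]⟩

theorem dslope_sin_ne_zero {z : ℂ} (hz : z ∈ Metric.ball (0 : ℂ) 3) :
    dslope Complex.sin 0 z ≠ 0 := by
  rcases eq_or_ne z 0 with rfl | h0
  · simp
  · rw [dslope_of_ne _ h0, slope_def_field]
    simp only [Complex.sin_zero, sub_zero, ne_eq, div_eq_zero_iff, h0, or_false]
    intro hs
    obtain ⟨k, hk⟩ := Complex.sin_eq_zero_iff.1 hs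
    have hk0 : k ≠ 0 := by rintro rfl; simp [h0] at hk
    have h1 : (1 : ℝ) ≤ |(k : ℝ)| := by exact_mod_cast Int.one_le_abs hk0
    rw [mem_ball_zero_iff, hk, norm_mul, Complex.norm_real, Real.norm_of_nonneg Real.pi_pos.le,
      Complex.norm_intCast] at hz
    nlinarith [Real.pi_gt_three]

theorem deriv_zero_of_even {F : ℂ → ℂ} (he : ∀ z, F (-z) = F z) :
    deriv F 0 = 0 := by
  have h := deriv_comp_neg F 0
  simp only [he, neg_zero] at h
  exact self_eq_neg.1 h

/-- The functions `t / sin t` and `1 / sin² t - 1 / t²` as convergent power series. -/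
theorem exists_ev_inv_sinc : ∃ q h : DiscSeries, ∀ t : ℝ, |t| ≤ 2 →
    q.ev t * Real.sin t = t ∧ h.ev t * t ^ 2 = q.ev t ^ 2 - 1 := by
  have hball : Metric.ball (0 : ℂ) 3 ∈ 𝓝 (0 : ℂ) := Metric.ball_mem_nhds _ (by norm_num)
  let F : ℂ → ℂ := fun z => (dslope Complex.sin 0 z)⁻¹
  have hF : DifferentiableOn ℂ F (Metric.ball 0 3) :=
    ((Complex.differentiableOn_dslope hball).2
      Complex.differentiable_sin.differentiableOn).inv fun z hz => dslope_sin_ne_zero hz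
  have hF0 : F 0 = 1 := by simp [F]
  have hFt : ∀ t : ℝ, t ≠ 0 → F t = ((t / Real.sin t : ℝ) : ℂ) := fun t ht => by
    have ht' : (t : ℂ) ≠ 0 := by exact_mod_cast ht
    simp [F, dslope_of_ne _ ht', slope_def_field]
  have heven : ∀ z, F (-z) = F z := fun z => by
    rcases eq_or_ne z 0 with rfl | h0
    · simp
    · simp [F, dslope_of_ne _ h0, dslope_of_ne _ (neg_ne_zero.2 h0), slope_def_field]
  have hF2 : DifferentiableOn ℂ (fun z => F z ^ 2) (Metric.ball 0 3) := hF.pow 2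
  have hd : deriv (fun z => F z ^ 2) 0 = 0 :=
    deriv_zero_of_even fun z => by rw [heven]
  obtain ⟨q, hq⟩ := exists_ev_eq_re hF
  obtain ⟨h, hh⟩ := exists_ev_eq_re (F := dslope (dslope (fun z => F z ^ 2) 0) 0)
    ((Complex.differentiableOn_dslope hball).2 ((Complex.differentiableOn_dslope hball).2 hF2))
  refine ⟨q, h, fun t ht => ?_⟩
  rcases eq_or_ne t 0 with rfl | h0
  · simp [hq 0 (by simp), hF0]
  · have h0' : (t : ℂ) ≠ 0 := by exact_mod_cast h0
    have hsin : Real.sin t ≠ 0 := by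
      have hz := dslope_sin_ne_zero (z := t) (by
        rw [mem_ball_zero_iff, Complex.norm_real, Real.norm_eq_abs]; linarith)
      rw [dslope_of_ne _ h0', slope_def_field] at hz
      intro hs
      apply hz
      rw [← Complex.ofReal_sin, hs]
      simp
    have hqt : q.ev t = t / Real.sin t := by rw [hq t ht, hFt t h0, Complex.ofReal_re]
    refine ⟨by rw [hqt]; field_simp, ?_⟩
    rw [hh t ht, dslope_of_ne _ h0', slope_def_field, dslope_of_ne _ h0', slope_def_field,
      dslope_same, hd, hF0, hFt t h0, hqt]
    have : ((((t / Real.sin t : ℝ) : ℂ) ^ 2 - 1 ^ 2) / ((t : ℂ) - 0) - 0) / ((t : ℂ) - 0)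
        = ((((t / Real.sin t) ^ 2 - 1) / t / t : ℝ) : ℂ) := by
      push_cast
      simp
    rw [this, Complex.ofReal_re]
    field_simp

end DiscSeries

namespace DiscSeries

theorem coeff_mul_eq_zero {f g : DiscSeries} {a b : ℕ} (hf : ∀ n < a, f.coeff n = 0)
    (hg : ∀ n < b, g.coeff n = 0) : ∀ n < a + b, (f * g).coeff n = 0 := by
  intro n hn
  have h := coeff_mul_mul_pow f g n 1
  rw [one_pow, mul_one] at h
  rw [h]
  refine Finset.sum_eq_zero fun k hk => ?_
  have hk' := Finset.HasAntidiagonal.mem_antidiagonal.1 hk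
  by_cases h1 : k.1 < a
  · simp [hf _ h1]
  · simp [hg k.2 (by omega)]

theorem norm_avg_le {f : DiscSeries} {d : ℕ} (hf : ∀ n < d, f.coeff n = 0) (p : ℕ) :
    ‖avg p f‖ ≤ ‖f‖ / (d + 1) := by
  rw [norm_def, norm_def, div_eq_mul_inv, ← tsum_mul_right]
  refine Summable.tsum_le_tsum (fun n => ?_) (summable_coeff _)
    ((summable_coeff _).mul_right _)
  rw [coeff_avg]
  rcases lt_or_ge n d with hn | hn
  · simp [hf n hn]
  · have h1 : (d : ℝ) ≤ n := by exact_mod_cast hn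
    rw [norm_mul, norm_mul, norm_div, ← div_eq_mul_inv, div_mul_eq_mul_div]
    rw [Real.norm_of_nonneg (by positivity : (0 : ℝ) ≤ n + p + 1)]
    gcongr
    linarith [(Nat.cast_nonneg p : (0 : ℝ) ≤ p)]

/-- The singular Volterra operator `f ↦ a φ`, where `φ'' + (p / t) φ' = f` and `φ(0) = 0`. -/
def volterra (a : DiscSeries) (p : ℕ) : DiscSeries →L[ℝ] DiscSeries :=
  (ContinuousLinearMap.mul ℝ DiscSeries (a * X ^ 2)).comp ((avg 1).comp (avg p))

theorem volterra_apply (a : DiscSeries) (p : ℕ) (f : DiscSeries) :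
    volterra a p f = a * X ^ 2 * avg 1 (avg p f) := rfl

theorem volterra_pow_apply (a : DiscSeries) (p n : ℕ) (f : DiscSeries) :
    (∀ k < n, ((volterra a p ^ n) f).coeff k = 0) ∧
      ‖(volterra a p ^ n) f‖ ≤ ‖a * X ^ 2‖ ^ n / n.factorial * ‖f‖ := by
  induction n with
  | zero => simp
  | succ n ih =>
    obtain ⟨h0, h1⟩ := ih
    set g := (volterra a p ^ n) f with hg
    have hs : (volterra a p ^ (n + 1)) f = a * X ^ 2 * avg 1 (avg p g) := by
      rw [pow_succ', mul_apply_eq_comp, ← hg, volterra_apply]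
    have hX : ∀ k < 1, (a * X ^ 2).coeff k = 0 := fun k hk => by
      rw [pow_two, ← mul_assoc]
      refine coeff_mul_eq_zero (a := 0) (b := 1) (by simp) (fun j hj => ?_) k (by omega)
      simp [X, show j = 0 by omega]
    have ha : ∀ k < n, (avg p g).coeff k = 0 := fun k hk => by simp [h0 k hk]
    rw [hs]
    refine ⟨fun k hk => coeff_mul_eq_zero hX (b := n) (fun j hj => ?_) k (by omega), ?_⟩
    · simp [h0 j hj]
    · calc ‖a * X ^ 2 * avg 1 (avg p g)‖ ≤ ‖a * X ^ 2‖ * (‖g‖ / (n + 1)) := by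
            refine (norm_mul_le _ _).trans ?_
            gcongr
            refine (norm_avg_le ha 1).trans ?_
            gcongr
            simpa using norm_avg_le (f := g) (d := 0) (by simp) p
        _ ≤ ‖a * X ^ 2‖ * (‖a * X ^ 2‖ ^ n / n.factorial * ‖f‖ / (n + 1)) := by gcongr
        _ = _ := by
            rw [Nat.factorial_succ]
            push_cast
            field_simp
            ring

theorem isUnit_one_sub_volterra (a : DiscSeries) (p : ℕ) : IsUnit (1 - volterra a p) := by
  obtain ⟨n, hn⟩ := ((FloorSemiring.tendsto_pow_div_factorial_atTop ‖a * X ^ 2‖).eventually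
    (gt_mem_nhds one_pos)).exists
  have hK : ‖volterra a p ^ n‖ < 1 :=
    (ContinuousLinearMap.opNorm_le_bound _ (by positivity)
      fun f => (volterra_pow_apply a p n f).2).trans_lt hn
  have hc : Commute (1 - volterra a p) (∑ i ∈ Finset.range n, volterra a p ^ i) :=
    Commute.sum_right _ _ _ fun i _ =>
      (Commute.one_left _).sub_left ((Commute.refl _).pow_right i)
  have h := isUnit_one_sub_of_norm_lt_one (R := DiscSeries →L[ℝ] DiscSeries) hK
  rw [← mul_neg_geom_sum] at h
  exact (hc.isUnit_mul_iff.1 h).1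

end DiscSeries

/-- Solvability, for small parameters, of an equation `x = b(ℓ) + ℓ R(ℓ, x)`. -/
theorem exists_solution_of_small_parameter {V : Type*} [NormedAddCommGroup V] [NormedSpace ℝ V]
    [CompleteSpace V] {b : ℝ → V} (hb : ContDiff ℝ 1 b) {R : ℝ × V → V} (hR : ContDiff ℝ 1 R) :
    ∃ C : ℝ, ∀ᶠ ℓ : ℝ in 𝓝 0, ∃ x : V, ‖x‖ ≤ C ∧ x = b ℓ + ℓ • R (ℓ, x) := by
  let F : ℝ × V → ℝ × V := fun w => (w.1, w.2 - b w.1 - w.1 • R w)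
  have hF : ContDiff ℝ 1 F := by fun_prop
  have hd : HasStrictFDerivAt F (fderiv ℝ F (0, b 0)) (0, b 0) :=
    hF.contDiffAt.hasStrictFDerivAt one_ne_zero
  have hsurj : (fderiv ℝ F (0, b 0)).range = ⊤ := by
    rw [LinearMap.range_eq_top]
    have hR' := (hR.differentiable one_ne_zero (0, b 0)).hasFDerivAt
    have hb' := (hb.differentiable one_ne_zero 0).hasFDerivAt
    have h1 : HasFDerivAt (fun w : ℝ × V => w.1) (ContinuousLinearMap.fst ℝ ℝ V) (0, b 0) :=
      hasFDerivAt_fst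
    have h2 : HasFDerivAt (fun w : ℝ × V => w.2) (ContinuousLinearMap.snd ℝ ℝ V) (0, b 0) :=
      hasFDerivAt_snd
    have hF' : HasFDerivAt F _ (0, b 0) :=
      h1.prodMk ((h2.sub (HasFDerivAt.comp ((0 : ℝ), b 0) (g := b) hb' h1)).sub (h1.smul hR'))
    rw [hF'.fderiv]
    intro y
    refine ⟨(y.1, y.2 + fderiv ℝ b 0 y.1 + y.1 • R (0, b 0)), ?_⟩
    ext
    · simp
    · simp
      abel
  have hmap := hd.map_nhds_eq_of_surj hsurj
  have hF0 : F (0, b 0) = (0, 0) := by simp [F]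
  rw [hF0] at hmap
  refine ⟨‖b 0‖ + 1, ?_⟩
  have hball : Metric.ball ((0 : ℝ), b 0) 1 ∈ 𝓝 ((0 : ℝ), b 0) := Metric.ball_mem_nhds _ one_pos
  have himg : F '' Metric.ball (0, b 0) 1 ∈ 𝓝 ((0 : ℝ), (0 : V)) := by
    rw [← hmap]
    exact image_mem_map hball
  have ht : Tendsto (fun ℓ : ℝ => (ℓ, (0 : V))) (𝓝 0) (𝓝 (0, 0)) := by
    have : Continuous fun ℓ : ℝ => (ℓ, (0 : V)) := by fun_prop
    exact this.tendsto' _ _ rfl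
  filter_upwards [ht himg] with ℓ hℓ
  obtain ⟨⟨a, x⟩, hx, hxe⟩ := hℓ
  obtain ⟨rfl, hxe⟩ := Prod.ext_iff.1 hxe
  simp only [F] at hxe
  refine ⟨x, ?_, ?_⟩
  · have h2 : dist x (b 0) < 1 := (le_max_right _ _).trans_lt hx
    rw [dist_eq_norm] at h2
    linarith [norm_le_norm_add_norm_sub' x (b 0)]
  · rw [sub_sub, sub_eq_zero] at hxe
    exact hxe

/-- `j (N - j)`, the squared value of `ω_j` at the origin. -/
def weight (N j : ℕ) : ℝ := (j : ℝ) * ((N : ℝ) - j)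

/-- Extension of a vector indexed by `1, …, N - 1` to all natural indices. -/
def extVec {N : ℕ} (v : Fin (N - 1) → ℝ) (j : ℕ) : ℝ :=
  if h : j - 1 < N - 1 then v ⟨j - 1, h⟩ else 0

theorem extVec_succ {N : ℕ} (v : Fin (N - 1) → ℝ) (j : Fin (N - 1)) :
    extVec v ((j : ℕ) + 1) = v j := by
  simp [extVec]

theorem extVec_of_le {N : ℕ} (v : Fin (N - 1) → ℝ) {j : ℕ} (hj : N ≤ j) : extVec v j = 0 := by
  rw [extVec, dif_neg (by omega)]

theorem matA_mulVec (N : ℕ) (v : Fin (N - 1) → ℝ) (i : Fin (N - 1)) :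
    (matA N).mulVec v i
      = 2 * weight N (i + 1) * extVec v (i + 1) - weight N (i + 2) * extVec v (i + 2)
        - weight N i * extVec v i := by
  have hi := i.2
  have h : ∀ j : Fin (N - 1), matA N i j * v j
      = (if (j : ℕ) = (i : ℕ) then 2 * weight N (i + 1) * extVec v (i + 1) else 0)
        + (if (j : ℕ) = (i : ℕ) + 1 then -(weight N (i + 2) * extVec v (i + 2)) else 0)
        + (if (j : ℕ) + 1 = (i : ℕ) then -(weight N i * extVec v i) else 0) := by
    intro j
    have hvj := extVec_succ v j
    simp only [matA, Matrix.of_apply]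
    by_cases h1 : (j : ℕ) = i
    · have h1' : i = j := Fin.ext h1.symm
      subst h1'
      rw [hvj]
      simp [weight]
    · have h1' : i ≠ j := fun h => h1 (by rw [h])
      by_cases h2 : (j : ℕ) = (i : ℕ) + 1
      · rw [show (i : ℕ) + 2 = j + 1 by omega, hvj, if_neg h1', if_pos (Or.inl h2.symm),
          if_neg h1, if_pos h2, if_neg (by omega)]
        simp [weight]
      · by_cases h3 : (j : ℕ) + 1 = i
        · rw [← h3, hvj]
          rw [if_neg h1', if_pos (Or.inr rfl), if_neg (by omega), if_neg (by omega), if_pos rfl]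
          simp [weight]
        · rw [if_neg h1', if_neg (by omega), if_neg h1, if_neg h2, if_neg h3]
          simp
  rw [Matrix.mulVec, dotProduct, Finset.sum_congr rfl fun j _ => h j, Finset.sum_add_distrib,
    Finset.sum_add_distrib]
  have s1 : ∀ c : ℝ, ∑ j : Fin (N - 1), (if (j : ℕ) = (i : ℕ) then c else 0) = c := fun c => by
    rw [Fin.sum_univ_eq_sum_range (fun j => if j = (i : ℕ) then c else 0)]
    simp
  have s2 : ∑ j : Fin (N - 1), (if (j : ℕ) = (i : ℕ) + 1
      then -(weight N (i + 2) * extVec v (i + 2)) else 0)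
        = -(weight N (i + 2) * extVec v (i + 2)) := by
    rw [Fin.sum_univ_eq_sum_range
      (fun j => if j = (i : ℕ) + 1 then -(weight N (i + 2) * extVec v (i + 2)) else 0)]
    rw [Finset.sum_ite_eq']
    split_ifs with h
    · rfl
    · rw [extVec_of_le v (by simp at h; omega)]
      simp
  have s3 : ∑ j : Fin (N - 1), (if (j : ℕ) + 1 = (i : ℕ)
      then -(weight N i * extVec v i) else 0) = -(weight N i * extVec v i) := by
    rcases Nat.eq_zero_or_pos (i : ℕ) with h0 | h0
    · simp [h0, weight]
    · rw [Fin.sum_univ_eq_sum_range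
        (fun j => if j + 1 = (i : ℕ) then -(weight N i * extVec v i) else 0)]
      rw [Finset.sum_eq_single ((i : ℕ) - 1)]
      · rw [if_pos (by omega)]
      · intro b _ hb
        rw [if_neg (by omega)]
      · intro hb
        simp at hb
        omega
  rw [s1, s2, s3]
  ring

/-- The binomial function `j ↦ j.choose e`. -/
def chooseVec (n e : ℕ) : Fin n → ℝ := fun j => ((j : ℕ).choose e : ℝ)

/-- The span of the first `d` binomial functions: polynomials of degree `< d`. -/
def degreeLT (n d : ℕ) : Submodule ℝ (Fin n → ℝ) :=
  Submodule.span ℝ (chooseVec n '' Set.Iio d)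

theorem chooseVec_mem {n e d : ℕ} (h : e < d) : chooseVec n e ∈ degreeLT n d :=
  Submodule.subset_span ⟨e, h, rfl⟩

theorem degreeLT_induction {n d : ℕ} {p : (Fin n → ℝ) → Prop} (hb : ∀ e < d, p (chooseVec n e))
    (h0 : p 0) (hadd : ∀ x y, p x → p y → p (x + y)) (hsmul : ∀ (c : ℝ) x, p x → p (c • x))
    {w : Fin n → ℝ} (hw : w ∈ degreeLT n d) : p w := by
  refine Submodule.span_induction (p := fun x _ => p x) ?_ h0 (fun x y _ _ => hadd x y)
    (fun c x _ => hsmul c x) hw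
  rintro _ ⟨e, he, rfl⟩
  exact hb e he

theorem degreeLT_mono {n d d' : ℕ} (h : d ≤ d') : degreeLT n d ≤ degreeLT n d' :=
  Submodule.span_mono (Set.image_mono (Set.Iio_subset_Iio h))

theorem mem_degreeLT_self {n : ℕ} (w : Fin n → ℝ) : w ∈ degreeLT n n := by
  let f : ℕ → ℝ := fun j => if h : j < n then w ⟨j, h⟩ else 0
  have h : w = ∑ e ∈ Finset.range n, ((fwdDiff 1)^[e] f 0) • chooseVec n e := by
    funext j
    have hj := shift_eq_sum_fwdDiff_iter 1 f (j : ℕ) 0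
    have hw : w j = f (0 + (j : ℕ) • 1) := by simp [f]
    rw [hw, hj]
    simp only [Finset.sum_apply, Pi.smul_apply, chooseVec, smul_eq_mul, nsmul_eq_mul]
    rw [Finset.sum_congr rfl fun e _ => mul_comm _ _]
    refine Finset.sum_subset (Finset.range_subset_range.2 j.2) fun e _ he => ?_
    rw [Nat.choose_eq_zero_of_lt (by simpa using he)]
    simp
  rw [h]
  exact Submodule.sum_mem _ fun e he =>
    Submodule.smul_mem _ _ (chooseVec_mem (Finset.mem_range.1 he))

theorem second_difference_choose (N d i : ℕ) :
    2 * weight N (i + 1) * (i.choose (d + 1) : ℝ) - weight N (i + 2) * ((i + 1).choose (d + 1) : ℝ)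
        - weight N i * ((i - 1).choose (d + 1) : ℝ)
      = ((d : ℝ) + 3) * (d + 2) * (i.choose (d + 1) : ℝ)
        - ((N : ℝ) - d - 2) * (d + 2) * (i.choose d : ℝ) := by
  rcases i with _ | k
  · rcases d with _ | d
    · simp [weight]
      ring
    · have : Nat.choose 1 (d + 1 + 1) = 0 := Nat.choose_eq_zero_of_lt (by omega)
      simp [weight, this]
  · have h1 : ((k : ℝ) + 1) * (k.choose d : ℝ) = ((k + 1).choose (d + 1) : ℝ) * (d + 1) := by
      exact_mod_cast Nat.add_one_mul_choose_eq k d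
    have h2 : ((k : ℝ) + 1 + 1) * ((k + 1).choose d : ℝ)
        = ((k + 1 + 1).choose (d + 1) : ℝ) * (d + 1) := by
      exact_mod_cast Nat.add_one_mul_choose_eq (k + 1) d
    have h3 : ((k + 1 + 1).choose (d + 1) : ℝ)
        = ((k + 1).choose d : ℝ) + ((k + 1).choose (d + 1) : ℝ) := by
      exact_mod_cast Nat.choose_succ_succ (k + 1) d
    have h4 : ((k + 1).choose (d + 1) : ℝ) = (k.choose d : ℝ) + (k.choose (d + 1) : ℝ) := by
      exact_mod_cast Nat.choose_succ_succ k d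
    simp only [weight, Nat.add_sub_cancel]
    push_cast
    rw [h3] at h2 ⊢
    linear_combination (-((N : ℝ) - k - d - 5)) * h2 + ((N : ℝ) - k - 1) * h1
      + (k + 1) * ((N : ℝ) - k - 1) * h4

theorem matA_mulVec_chooseVec (N e : ℕ) :
    (matA N).mulVec (chooseVec (N - 1) e) - (((e : ℝ) + 2) * (e + 1)) • chooseVec (N - 1) e
      ∈ degreeLT (N - 1) e := by
  have hext : ∀ (i : Fin (N - 1)), (matA N).mulVec (chooseVec (N - 1) e) i
      = 2 * weight N (i + 1) * ((i : ℕ).choose e : ℝ)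
        - weight N (i + 2) * (((i : ℕ) + 1).choose e : ℝ)
        - weight N i * (((i : ℕ) - 1).choose e : ℝ) := by
    intro i
    have hi := i.2
    rw [matA_mulVec, extVec_succ]
    congr 1
    · congr 1
      by_cases h : (i : ℕ) + 1 < N - 1
      · rw [extVec, dif_pos (by omega)]
        simp [chooseVec]
      · have : weight N (i + 2) = 0 := by
          have : (i : ℕ) + 2 = N := by omega
          simp [weight, this]
        rw [this, zero_mul, zero_mul]
    · rw [extVec, dif_pos (by omega)]
      simp [chooseVec]
  rcases e with _ | d
  · have h : (matA N).mulVec (chooseVec (N - 1) 0)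
        - ((((0 : ℕ) : ℝ) + 2) * ((0 : ℕ) + 1)) • chooseVec (N - 1) 0 = 0 := by
      funext i
      rw [Pi.sub_apply, hext]
      simp [chooseVec, weight]
      ring
    rw [h]
    exact Submodule.zero_mem _
  · have h : (matA N).mulVec (chooseVec (N - 1) (d + 1))
        - ((((d + 1 : ℕ) : ℝ) + 2) * ((d + 1 : ℕ) + 1)) • chooseVec (N - 1) (d + 1)
        = (-(((N : ℝ) - d - 2) * (d + 2))) • chooseVec (N - 1) d := by
      funext i
      rw [Pi.sub_apply, hext, second_difference_choose]
      simp [chooseVec]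
      ring
    rw [h]
    exact Submodule.smul_mem _ _ (chooseVec_mem (Nat.lt_succ_self d))

theorem matA_mulVec_mem {N d : ℕ} {w : Fin (N - 1) → ℝ} (hw : w ∈ degreeLT (N - 1) d) :
    (matA N).mulVec w ∈ degreeLT (N - 1) d := by
  refine degreeLT_induction (p := fun w => (matA N).mulVec w ∈ degreeLT (N - 1) d)
    (fun e he => ?_) ?_ (fun x y hx hy => ?_) (fun c x hx => ?_) hw
  · have h := Submodule.add_mem _ (degreeLT_mono he.le (matA_mulVec_chooseVec N e))
      (Submodule.smul_mem _ (((e : ℝ) + 2) * (e + 1)) (chooseVec_mem he))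
    rwa [sub_add_cancel] at h
  · simp
  · rw [Matrix.mulVec_add]
    exact Submodule.add_mem _ hx hy
  · rw [Matrix.mulVec_smul]
    exact Submodule.smul_mem _ _ hx

theorem matA_mulVec_sub_mem {N d : ℕ} {w : Fin (N - 1) → ℝ} (hw : w ∈ degreeLT (N - 1) (d + 1)) :
    (matA N).mulVec w - (((d : ℝ) + 2) * (d + 1)) • w ∈ degreeLT (N - 1) d := by
  refine degreeLT_induction
    (p := fun w => (matA N).mulVec w - (((d : ℝ) + 2) * (d + 1)) • w ∈ degreeLT (N - 1) d)
    (fun e he => ?_) ?_ (fun x y hx hy => ?_) (fun c x hx => ?_) hw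
  · rcases Nat.lt_succ_iff_lt_or_eq.1 he with h | rfl
    · exact Submodule.sub_mem _ (matA_mulVec_mem (chooseVec_mem h))
        (Submodule.smul_mem _ _ (chooseVec_mem h))
    · exact matA_mulVec_chooseVec N e
  · simp
  · rw [Matrix.mulVec_add, smul_add, add_sub_add_comm]
    exact Submodule.add_mem _ hx hy
  · rw [Matrix.mulVec_smul, smul_comm, ← smul_sub]
    exact Submodule.smul_mem _ _ hx

theorem natCast_mul_mem {n d : ℕ} {w : Fin n → ℝ} (hw : w ∈ degreeLT n d) :
    (fun j : Fin n => ((j : ℕ) : ℝ) * w j) ∈ degreeLT n (d + 1) := by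
  refine degreeLT_induction
    (p := fun w => (fun j : Fin n => ((j : ℕ) : ℝ) * w j) ∈ degreeLT n (d + 1))
    (fun e he => ?_) ?_ (fun x y hx hy => ?_) (fun c x hx => ?_) hw
  · have h : (fun j : Fin n => ((j : ℕ) : ℝ) * chooseVec n e j)
        = ((e : ℝ) + 1) • chooseVec n (e + 1) + (e : ℝ) • chooseVec n e := by
      funext j
      have h1 : ((j : ℕ) + 1 : ℝ) * ((j : ℕ).choose e : ℝ)
          = (((j : ℕ) + 1).choose (e + 1) : ℝ) * (e + 1) := by
        exact_mod_cast Nat.add_one_mul_choose_eq (j : ℕ) e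
      have h2 : (((j : ℕ) + 1).choose (e + 1) : ℝ)
          = ((j : ℕ).choose e : ℝ) + ((j : ℕ).choose (e + 1) : ℝ) := by
        exact_mod_cast Nat.choose_succ_succ (j : ℕ) e
      simp only [chooseVec, Pi.add_apply, Pi.smul_apply, smul_eq_mul]
      rw [h2] at h1
      linear_combination h1
    rw [h]
    exact Submodule.add_mem _ (Submodule.smul_mem _ _ (chooseVec_mem (by omega)))
      (Submodule.smul_mem _ _ (chooseVec_mem (by omega)))
  · simp only [Pi.zero_apply, mul_zero]
    exact Submodule.zero_mem _
  · convert! Submodule.add_mem _ hx hy using 1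
    funext j
    simp [mul_add]
  · convert! Submodule.smul_mem _ c hx using 1
    funext j
    simp
    ring

theorem mul_chooseVec_mem {n d : ℕ} {w : Fin n → ℝ} (hw : w ∈ degreeLT n d) (b : ℕ) :
    w * chooseVec n b ∈ degreeLT n (d + b) := by
  induction b with
  | zero =>
    have h : w * chooseVec n 0 = w := by
      funext j
      simp [chooseVec]
    rwa [h]
  | succ b ih =>
    have h : w * chooseVec n (b + 1) = ((b : ℝ) + 1)⁻¹ •
        ((fun j : Fin n => ((j : ℕ) : ℝ) * (w * chooseVec n b) j)
          - (b : ℝ) • (w * chooseVec n b)) := by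
      funext j
      have h1 : ((j : ℕ) + 1 : ℝ) * ((j : ℕ).choose b : ℝ)
          = (((j : ℕ) + 1).choose (b + 1) : ℝ) * (b + 1) := by
        exact_mod_cast Nat.add_one_mul_choose_eq (j : ℕ) b
      have h2 : (((j : ℕ) + 1).choose (b + 1) : ℝ)
          = ((j : ℕ).choose b : ℝ) + ((j : ℕ).choose (b + 1) : ℝ) := by
        exact_mod_cast Nat.choose_succ_succ (j : ℕ) b
      simp only [chooseVec, Pi.mul_apply, Pi.sub_apply, Pi.smul_apply, smul_eq_mul]
      rw [h2] at h1
      field_simp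
      linear_combination (-(w j)) * h1
    rw [h]
    exact Submodule.smul_mem _ _ (Submodule.sub_mem _ (natCast_mul_mem ih)
      (Submodule.smul_mem _ _ (degreeLT_mono (by omega) ih)))

theorem mul_mem_degreeLT {n a b : ℕ} {x y : Fin n → ℝ} (hx : x ∈ degreeLT n a)
    (hy : y ∈ degreeLT n (b + 1)) : x * y ∈ degreeLT n (a + b) := by
  refine degreeLT_induction (p := fun y => x * y ∈ degreeLT n (a + b))
    (fun e he => degreeLT_mono (by omega) (mul_chooseVec_mem hx e)) ?_
    (fun y z hy hz => ?_) (fun c z hz => ?_) hy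
  · simp
  · rw [mul_add]
    exact Submodule.add_mem _ hy hz
  · rw [mul_smul_comm]
    exact Submodule.smul_mem _ _ hz

namespace IsEigenBasis

variable {N : ℕ} {v : Fin (N - 1) → Fin (N - 1) → ℝ}

theorem mulVec (hv : IsEigenBasis N v) (i : Fin (N - 1)) :
    (matA N).mulVec (v i) = (((i : ℕ) + 2 : ℝ) * ((i : ℕ) + 1)) • v i := by
  rw [(hv i).2]
  push_cast
  rfl

theorem eigenvalue_injective {a b : ℕ}
    (h : ((a : ℝ) + 2) * (a + 1) = ((b : ℝ) + 2) * (b + 1)) : a = b := by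
  have h' : (a + 2) * (a + 1) = (b + 2) * (b + 1) := by exact_mod_cast h
  nlinarith [lt_trichotomy a b]

theorem linearIndependent (hv : IsEigenBasis N v) : LinearIndependent ℝ v :=
  Module.End.eigenvectors_linearIndependent' (Matrix.toLin' (matA N))
    (fun i : Fin (N - 1) => (((i : ℕ) + 2 : ℝ) * ((i : ℕ) + 1)))
    (fun _ _ h => Fin.ext (eigenvalue_injective h)) v
    (fun i => ⟨Module.End.mem_eigenspace_iff.2 (by
      rw [Matrix.toLin'_apply]; exact hv.mulVec i), (hv i).1⟩)

theorem mem_degreeLT (hv : IsEigenBasis N v) (i : Fin (N - 1)) :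
    v i ∈ degreeLT (N - 1) ((i : ℕ) + 1) := by
  classical
  have hex : ∃ d, v i ∈ degreeLT (N - 1) d := ⟨_, mem_degreeLT_self (v i)⟩
  have hd := Nat.find_spec hex
  rcases hfind : Nat.find hex with _ | d
  · rw [hfind] at hd
    simp [degreeLT] at hd
    exact absurd hd (hv i).1
  · rw [hfind] at hd
    have h := matA_mulVec_sub_mem hd
    rw [hv.mulVec, ← sub_smul] at h
    by_cases hi : (i : ℕ) = d
    · rwa [hi]
    · have hne : ((i : ℕ) + 2 : ℝ) * ((i : ℕ) + 1) - ((d : ℝ) + 2) * (d + 1) ≠ 0 := fun h0 =>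
        hi (eigenvalue_injective (sub_eq_zero.1 h0))
      have h' := (Submodule.smul_mem_iff _ hne).1 h
      have := Nat.find_min' hex h'
      omega

/-- The basis of eigenvectors. -/
def basis (hv : IsEigenBasis N v) : Module.Basis (Fin (N - 1)) ℝ (Fin (N - 1) → ℝ) :=
  basisOfLinearIndependentOfCardEqFinrank' v hv.linearIndependent (by simp)

theorem basis_apply (hv : IsEigenBasis N v) (i : Fin (N - 1)) : hv.basis i = v i := by
  simp [basis]

theorem repr_mulVec (hv : IsEigenBasis N v) (w : Fin (N - 1) → ℝ) (c : Fin (N - 1)) :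
    hv.basis.repr ((matA N).mulVec w) c
      = (((c : ℕ) + 2 : ℝ) * ((c : ℕ) + 1)) * hv.basis.repr w c := by
  conv_lhs => rw [← hv.basis.sum_repr w]
  rw [← Matrix.toLin'_apply, map_sum, map_sum]
  simp only [map_smul, Matrix.toLin'_apply, hv.basis_apply, hv.mulVec]
  simp only [← hv.basis_apply, Finsupp.coe_finsetSum, Finset.sum_apply, Finsupp.smul_apply,
    Module.Basis.repr_self, smul_eq_mul, Finsupp.single_apply]
  rw [Finset.sum_eq_single c (fun b _ hb => by simp [hb]) (by simp)]
  simp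
  ring

theorem repr_eq_zero (hv : IsEigenBasis N v) {d : ℕ} :
    ∀ {w : Fin (N - 1) → ℝ}, w ∈ degreeLT (N - 1) d → ∀ c : Fin (N - 1), d ≤ c →
      hv.basis.repr w c = 0 := by
  induction d with
  | zero =>
    intro w hw c _
    have : w = 0 := by simpa [degreeLT] using hw
    simp [this]
  | succ d ih =>
    intro w hw c hc
    have h := ih (matA_mulVec_sub_mem hw) c (by omega)
    rw [map_sub, map_smul, Finsupp.sub_apply, repr_mulVec, Finsupp.smul_apply, smul_eq_mul,
      ← sub_mul] at h
    refine (mul_eq_zero.1 h).resolve_left fun h0 => ?_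
    have := eigenvalue_injective (sub_eq_zero.1 h0)
    omega

/-- Products of eigenvectors expand triangularly in the eigenbasis. -/
theorem exists_structure_constants (hv : IsEigenBasis N v) :
    ∃ C : Fin (N - 1) → Fin (N - 1) → Fin (N - 1) → ℝ,
      (∀ a b c : Fin (N - 1), (a : ℕ) + (b : ℕ) < (c : ℕ) → C a b c = 0) ∧
      ∀ a b j, extVec (v a) j * extVec (v b) j = ∑ c, C a b c * extVec (v c) j := by
  refine ⟨fun a b c => hv.basis.repr (v a * v b) c, fun a b c h => ?_, fun a b j => ?_⟩
  · refine hv.repr_eq_zero (mul_mem_degreeLT (hv.mem_degreeLT a) (hv.mem_degreeLT b)) c ?_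
    omega
  · by_cases hj : j - 1 < N - 1
    · simp only [extVec, dif_pos hj]
      have h := congrFun (hv.basis.sum_repr (v a * v b)) ⟨j - 1, hj⟩
      simpa [hv.basis_apply] using h.symm
    · simp [extVec, hj]

theorem second_difference (hv : IsEigenBasis N v) (i : Fin (N - 1)) {j : ℕ}
    (hj : j ∈ Finset.Icc 1 (N - 1)) :
    2 * weight N j * extVec (v i) j - weight N (j + 1) * extVec (v i) (j + 1)
        - weight N (j - 1) * extVec (v i) (j - 1)
      = ((i : ℕ) + 2 : ℝ) * ((i : ℕ) + 1) * extVec (v i) j := by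
  rw [Finset.mem_Icc] at hj
  obtain ⟨k, rfl⟩ : ∃ k, j = k + 1 := ⟨j - 1, by omega⟩
  have h := congrFun (hv.mulVec i) ⟨k, by omega⟩
  rw [matA_mulVec] at h
  have hk := extVec_succ (v i) ⟨k, by omega⟩
  simp only at hk h
  rw [Nat.add_sub_cancel, h, Pi.smul_apply, smul_eq_mul, hk]

end IsEigenBasis

open DiscSeries

variable {N : ℕ}

/-- The eigenvalue `k (k - 1)` of `matA N` with `k = i + 2`. -/
def eigenval (i : ℕ) : ℝ := ((i : ℝ) + 2) * (i + 1)

/-- The averaged series `U_i` with `(θ ^ (2 k + 1) U_i)' = θ ^ (2 k) f_i`, where `k = i + 2`. -/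
def slopeSeries (f : Fin (N - 1) → DiscSeries) (i : Fin (N - 1)) : DiscSeries :=
  avg (2 * ((i : ℕ) + 2)) (f i)

/-- The coefficient `φ_i` of the eigenvector `v i`, with `φ_i' = θ U_i`. -/
def profileSeries (z : Fin (N - 1) → ℝ) (ℓ : ℝ) (f : Fin (N - 1) → DiscSeries)
    (i : Fin (N - 1)) : DiscSeries :=
  (z i * ℓ ^ (i : ℕ)) • 1 + X ^ 2 * avg 1 (slopeSeries f i)

/-- The series `k φ_i + θ² U_i`. -/
def derivSeries (z : Fin (N - 1) → ℝ) (ℓ : ℝ) (f : Fin (N - 1) → DiscSeries)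
    (i : Fin (N - 1)) : DiscSeries :=
  ((i : ℝ) + 2) • profileSeries z ℓ f i + X ^ 2 * slopeSeries f i

/-- The `j`-th component of `∑ θ ^ i φ_i v_i`. -/
def combine (v : Fin (N - 1) → Fin (N - 1) → ℝ) (φ : Fin (N - 1) → DiscSeries) (j : ℕ) :
    DiscSeries :=
  ∑ i, extVec (v i) j • (X ^ (i : ℕ) * φ i)

/-- The product on coefficient families that `combine` turns into the componentwise product. -/
def starMul (C : Fin (N - 1) → Fin (N - 1) → Fin (N - 1) → ℝ) (φ χ : Fin (N - 1) → DiscSeries)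
    (c : Fin (N - 1)) : DiscSeries :=
  ∑ a, ∑ b, C a b c • (X ^ ((a : ℕ) + (b : ℕ) - (c : ℕ)) * (φ a * χ b))

/-- The action of `matA N` on coefficient families. -/
def eigenMul (φ : Fin (N - 1) → DiscSeries) (i : Fin (N - 1)) : DiscSeries := eigenval i • φ i

/-- The nonlinear part of the Yang–Mills potential term. -/
def potentialSeries (C : Fin (N - 1) → Fin (N - 1) → Fin (N - 1) → ℝ) (ℓ : ℝ)
    (φ : Fin (N - 1) → DiscSeries) (i : Fin (N - 1)) : DiscSeries :=
  starMul C φ (eigenMul φ) i + (1 / 2 : ℝ) • eigenMul (starMul C φ φ) i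
    + (ℓ ^ 2 / 2) • (X ^ 2 * starMul C φ (eigenMul (starMul C φ φ)) i)

/-- The rescaled series of `r⁴ p_θ`. -/
def pressureSeries (v : Fin (N - 1) → Fin (N - 1) → ℝ) (ℓ : ℝ)
    (φ : Fin (N - 1) → DiscSeries) : DiscSeries :=
  (4 : ℝ) • ∑ j ∈ Finset.Icc 1 N,
    (weight N j • (combine v φ j + (ℓ ^ 2 / 2) • (X ^ 2 * combine v φ j ^ 2))
      - weight N (j - 1) •
        (combine v φ (j - 1) + (ℓ ^ 2 / 2) • (X ^ 2 * combine v φ (j - 1) ^ 2))) ^ 2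

/-- The rescaled kinetic term `∑ λ_j B_j²`. -/
def kineticSeries (v : Fin (N - 1) → Fin (N - 1) → ℝ) (B : Fin (N - 1) → DiscSeries) :
    DiscSeries :=
  ∑ j ∈ Finset.Icc 1 (N - 1), weight N j • combine v B j ^ 2

/-- The nonlinear part of the rescaled Yang–Mills equations. -/
def gaugeRemainder (v : Fin (N - 1) → Fin (N - 1) → ℝ)
    (C : Fin (N - 1) → Fin (N - 1) → Fin (N - 1) → ℝ) (z : Fin (N - 1) → ℝ) (q c : DiscSeries)
    (ℓ : ℝ) (f : Fin (N - 1) → DiscSeries) (G : DiscSeries) (i : Fin (N - 1)) : DiscSeries :=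
  ℓ • (q ^ 2 * potentialSeries C ℓ (profileSeries z ℓ f) i)
    + (2 : ℝ) • (avg 2 G * q * c ^ 3 * (X ^ 2 * f i + eigenMul (profileSeries z ℓ f) i))
    - ((2 : ℝ) • (avg 2 G * q ^ 2 * c ^ 2 * ((3 : ℝ) • 1 - (2 : ℝ) • c ^ 2))
      - (ℓ / 2) • (pressureSeries v ℓ (profileSeries z ℓ f) * c ^ 3 * q ^ 3))
      * derivSeries z ℓ f i

/-- The source of the rescaled mass equation. -/
def massSource (v : Fin (N - 1) → Fin (N - 1) → ℝ) (z : Fin (N - 1) → ℝ) (q c : DiscSeries)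
    (ℓ : ℝ) (f : Fin (N - 1) → DiscSeries) (G : DiscSeries) : DiscSeries :=
  (1 - (2 * ℓ) • (avg 2 G * X ^ 2 * q * c ^ 3)) * kineticSeries v (derivSeries z ℓ f)
    + (1 / 4 : ℝ) • (pressureSeries v ℓ (profileSeries z ℓ f) * q ^ 2)

section ContDiff

variable {E : Type*} [NormedAddCommGroup E] [NormedSpace ℝ E]
  {φ χ : E → Fin (N - 1) → DiscSeries} {ℓ : E → ℝ} {G : E → DiscSeries}

theorem contDiff_slopeSeries (hφ : ContDiff ℝ 1 φ) :
    ContDiff ℝ 1 fun x => slopeSeries (φ x) := by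
  unfold slopeSeries
  fun_prop

theorem contDiff_profileSeries (z : Fin (N - 1) → ℝ) (hℓ : ContDiff ℝ 1 ℓ)
    (hφ : ContDiff ℝ 1 φ) : ContDiff ℝ 1 fun x => profileSeries z (ℓ x) (φ x) := by
  have := contDiff_slopeSeries hφ
  unfold profileSeries
  fun_prop

theorem contDiff_derivSeries (z : Fin (N - 1) → ℝ) (hℓ : ContDiff ℝ 1 ℓ)
    (hφ : ContDiff ℝ 1 φ) : ContDiff ℝ 1 fun x => derivSeries z (ℓ x) (φ x) := by
  have := contDiff_slopeSeries hφ
  have := contDiff_profileSeries z hℓ hφ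
  unfold derivSeries
  fun_prop

theorem contDiff_combine (v : Fin (N - 1) → Fin (N - 1) → ℝ) (hφ : ContDiff ℝ 1 φ) (j : ℕ) :
    ContDiff ℝ 1 fun x => combine v (φ x) j := by
  unfold combine
  fun_prop

theorem contDiff_starMul (C : Fin (N - 1) → Fin (N - 1) → Fin (N - 1) → ℝ)
    (hφ : ContDiff ℝ 1 φ) (hχ : ContDiff ℝ 1 χ) :
    ContDiff ℝ 1 fun x => starMul C (φ x) (χ x) := by
  unfold starMul
  fun_prop

theorem contDiff_eigenMul (hφ : ContDiff ℝ 1 φ) : ContDiff ℝ 1 fun x => eigenMul (φ x) := by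
  unfold eigenMul
  fun_prop

theorem contDiff_potentialSeries (C : Fin (N - 1) → Fin (N - 1) → Fin (N - 1) → ℝ)
    (hℓ : ContDiff ℝ 1 ℓ) (hφ : ContDiff ℝ 1 φ) :
    ContDiff ℝ 1 fun x => potentialSeries C (ℓ x) (φ x) := by
  have := contDiff_starMul C hφ (contDiff_eigenMul hφ)
  have := contDiff_eigenMul (contDiff_starMul C hφ hφ)
  have := contDiff_starMul C hφ (contDiff_eigenMul (contDiff_starMul C hφ hφ))
  unfold potentialSeries
  fun_prop

theorem contDiff_pressureSeries (v : Fin (N - 1) → Fin (N - 1) → ℝ) (hℓ : ContDiff ℝ 1 ℓ)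
    (hφ : ContDiff ℝ 1 φ) : ContDiff ℝ 1 fun x => pressureSeries v (ℓ x) (φ x) := by
  have := contDiff_combine v hφ
  unfold pressureSeries
  fun_prop

theorem contDiff_kineticSeries (v : Fin (N - 1) → Fin (N - 1) → ℝ)
    (hφ : ContDiff ℝ 1 φ) : ContDiff ℝ 1 fun x => kineticSeries v (φ x) := by
  have := contDiff_combine v hφ
  unfold kineticSeries
  fun_prop

theorem contDiff_gaugeRemainder (v : Fin (N - 1) → Fin (N - 1) → ℝ)
    (C : Fin (N - 1) → Fin (N - 1) → Fin (N - 1) → ℝ) (z : Fin (N - 1) → ℝ) (q c : DiscSeries)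
    (hℓ : ContDiff ℝ 1 ℓ) (hφ : ContDiff ℝ 1 φ) (hG : ContDiff ℝ 1 G) :
    ContDiff ℝ 1 fun x => gaugeRemainder v C z q c (ℓ x) (φ x) (G x) := by
  have hp := contDiff_profileSeries z hℓ hφ
  have := contDiff_potentialSeries C hℓ hp
  have := contDiff_pressureSeries v hℓ hp
  have := contDiff_derivSeries z hℓ hφ
  have := contDiff_eigenMul hp
  unfold gaugeRemainder
  fun_prop

theorem contDiff_massSource (v : Fin (N - 1) → Fin (N - 1) → ℝ) (z : Fin (N - 1) → ℝ)
    (q c : DiscSeries) (hℓ : ContDiff ℝ 1 ℓ) (hφ : ContDiff ℝ 1 φ) (hG : ContDiff ℝ 1 G) :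
    ContDiff ℝ 1 fun x => massSource v z q c (ℓ x) (φ x) (G x) := by
  have hp := contDiff_profileSeries z hℓ hφ
  have := contDiff_pressureSeries v hℓ hp
  have := contDiff_kineticSeries v (contDiff_derivSeries z hℓ hφ)
  unfold massSource
  fun_prop

end ContDiff

/-- The rescaled field equations have uniformly bounded solutions for small length scales. -/
theorem exists_scaled_solution (v : Fin (N - 1) → Fin (N - 1) → ℝ)
    (C : Fin (N - 1) → Fin (N - 1) → Fin (N - 1) → ℝ) (z : Fin (N - 1) → ℝ)
    (q c h : DiscSeries) :
    ∃ K : ℝ, ∀ᶠ ℓ : ℝ in 𝓝 0, ∃ (f : Fin (N - 1) → DiscSeries) (G : DiscSeries),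
      ‖f‖ ≤ K ∧ ‖G‖ ≤ K ∧
      (∀ i, f i = eigenval i • (h * profileSeries z ℓ f i)
        + ℓ • gaugeRemainder v C z q c ℓ f G i) ∧
      G = ℓ • massSource v z q c ℓ f G := by
  choose P hP using fun i : Fin (N - 1) =>
    (isUnit_one_sub_volterra (eigenval i • h) (2 * ((i : ℕ) + 2))).exists_right_inv
  obtain ⟨K, hK⟩ := exists_solution_of_small_parameter
    (V := (Fin (N - 1) → DiscSeries) × DiscSeries)
    (b := fun ℓ => (fun i => P i ((eigenval i * (z i * ℓ ^ (i : ℕ))) • h), 0))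
    (by fun_prop)
    (R := fun p => (fun i => P i (gaugeRemainder v C z q c p.1 p.2.1 p.2.2 i),
      massSource v z q c p.1 p.2.1 p.2.2))
    (by
      have := contDiff_gaugeRemainder v C z q c (ℓ := fun p : ℝ × ((Fin (N - 1) → DiscSeries) ×
        DiscSeries) => p.1) (φ := fun p => p.2.1) (G := fun p => p.2.2) (by fun_prop)
        (by fun_prop) (by fun_prop)
      have := contDiff_massSource v z q c (ℓ := fun p : ℝ × ((Fin (N - 1) → DiscSeries) ×
        DiscSeries) => p.1) (φ := fun p => p.2.1) (G := fun p => p.2.2) (by fun_prop)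
        (by fun_prop) (by fun_prop)
      fun_prop)
  refine ⟨K, hK.mono ?_⟩
  rintro ℓ ⟨⟨f, G⟩, hn, hx⟩
  rw [Prod.norm_mk, max_le_iff] at hn
  obtain ⟨h1, h2⟩ := Prod.ext_iff.1 hx
  refine ⟨f, G, hn.1, hn.2, fun i => ?_, by simpa using h2⟩
  have h3 : f i = P i ((eigenval i * (z i * ℓ ^ (i : ℕ))) • h
      + ℓ • gaugeRemainder v C z q c ℓ f G i) := by
    rw [map_add, map_smul]
    exact (congrFun h1 i).trans (by simp)
  have h4 := congrArg (fun T => T ((eigenval i * (z i * ℓ ^ (i : ℕ))) • h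
      + ℓ • gaugeRemainder v C z q c ℓ f G i)) (hP i)
  simp only [mul_apply_eq_comp, ← h3, sub_apply,
    one_apply_eq_self, volterra_apply] at h4
  rw [sub_eq_iff_eq_add] at h4
  rw [h4, profileSeries, slopeSeries]
  simp only [mul_add, smul_add, mul_smul_comm, smul_mul_assoc, mul_one, smul_smul, mul_assoc]
  abel

variable {N : ℕ} {v : Fin (N - 1) → Fin (N - 1) → ℝ}

theorem combine_add (φ χ : Fin (N - 1) → DiscSeries) (j : ℕ) :
    combine v (φ + χ) j = combine v φ j + combine v χ j := by
  simp [combine, mul_add, Finset.sum_add_distrib]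

theorem combine_mul_left (a : DiscSeries) (φ : Fin (N - 1) → DiscSeries) (j : ℕ) :
    combine v (fun i => a * φ i) j = a * combine v φ j := by
  simp [combine, Finset.mul_sum, mul_left_comm]

theorem combine_smul (a : ℝ) (φ : Fin (N - 1) → DiscSeries) (j : ℕ) :
    combine v (a • φ) j = a • combine v φ j := by
  simp [combine, Finset.smul_sum, smul_comm a]

theorem combine_starMul {C : Fin (N - 1) → Fin (N - 1) → Fin (N - 1) → ℝ}
    (hC : ∀ a b c : Fin (N - 1), (a : ℕ) + (b : ℕ) < (c : ℕ) → C a b c = 0)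
    (hCv : ∀ a b j, extVec (v a) j * extVec (v b) j = ∑ c, C a b c * extVec (v c) j)
    (φ χ : Fin (N - 1) → DiscSeries) (j : ℕ) :
    combine v (starMul C φ χ) j = combine v φ j * combine v χ j := by
  have hterm : ∀ a b : Fin (N - 1),
      ∑ c, (C a b c * extVec (v c) j) •
        (X ^ (c : ℕ) * (X ^ ((a : ℕ) + (b : ℕ) - (c : ℕ)) * (φ a * χ b)))
      = (extVec (v a) j • (X ^ (a : ℕ) * φ a)) * (extVec (v b) j • (X ^ (b : ℕ) * χ b)) := by
    intro a b
    have h : ∀ c : Fin (N - 1), (C a b c * extVec (v c) j) •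
        (X ^ (c : ℕ) * (X ^ ((a : ℕ) + (b : ℕ) - (c : ℕ)) * (φ a * χ b)))
        = (C a b c * extVec (v c) j) • (X ^ ((a : ℕ) + (b : ℕ)) * (φ a * χ b)) := by
      intro c
      rcases lt_or_ge ((a : ℕ) + (b : ℕ)) (c : ℕ) with hlt | hge
      · simp [hC a b c hlt]
      · rw [← mul_assoc, ← pow_add, Nat.add_sub_cancel' hge]
    rw [Finset.sum_congr rfl fun c _ => h c, ← Finset.sum_smul, ← hCv, smul_mul_smul_comm]
    congr 1
    ring
  calc combine v (starMul C φ χ) j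
      = ∑ c, ∑ a, ∑ b, (C a b c * extVec (v c) j) •
        (X ^ (c : ℕ) * (X ^ ((a : ℕ) + (b : ℕ) - (c : ℕ)) * (φ a * χ b))) := by
        simp only [combine, starMul, Finset.mul_sum, Finset.smul_sum, mul_smul_comm, smul_smul,
          mul_comm]
    _ = ∑ a, ∑ b, ∑ c, (C a b c * extVec (v c) j) •
        (X ^ (c : ℕ) * (X ^ ((a : ℕ) + (b : ℕ) - (c : ℕ)) * (φ a * χ b))) := by
        rw [Finset.sum_comm]
        exact Finset.sum_congr rfl fun a _ => Finset.sum_comm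
    _ = _ := by
        rw [combine, combine, Finset.sum_mul_sum]
        exact Finset.sum_congr rfl fun a _ => Finset.sum_congr rfl fun b _ => hterm a b

theorem combine_eigenMul (hv : IsEigenBasis N v) (φ : Fin (N - 1) → DiscSeries) {j : ℕ}
    (hj : j ∈ Finset.Icc 1 (N - 1)) :
    combine v (eigenMul φ) j
      = (2 * weight N j) • combine v φ j - weight N (j + 1) • combine v φ (j + 1)
        - weight N (j - 1) • combine v φ (j - 1) := by
  simp only [combine, eigenMul, Finset.smul_sum, smul_smul, mul_smul_comm]
  rw [← Finset.sum_sub_distrib, ← Finset.sum_sub_distrib]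
  refine Finset.sum_congr rfl fun i _ => ?_
  rw [← sub_smul, ← sub_smul, hv.second_difference i hj, eigenval, mul_comm]

theorem combine_potentialSeries {C : Fin (N - 1) → Fin (N - 1) → Fin (N - 1) → ℝ}
    (hC : ∀ a b c : Fin (N - 1), (a : ℕ) + (b : ℕ) < (c : ℕ) → C a b c = 0)
    (hCv : ∀ a b j, extVec (v a) j * extVec (v b) j = ∑ c, C a b c * extVec (v c) j)
    (ℓ : ℝ) (φ : Fin (N - 1) → DiscSeries) (j : ℕ) :
    combine v (potentialSeries C ℓ φ) j
      = combine v φ j * combine v (eigenMul φ) j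
        + (1 / 2 : ℝ) • combine v (eigenMul (starMul C φ φ)) j
        + (ℓ ^ 2 / 2) • (X ^ 2 * (combine v φ j * combine v (eigenMul (starMul C φ φ)) j)) := by
  have h : potentialSeries C ℓ φ = starMul C φ (eigenMul φ)
      + (1 / 2 : ℝ) • eigenMul (starMul C φ φ)
      + (ℓ ^ 2 / 2) • (fun i => X ^ 2 * starMul C φ (eigenMul (starMul C φ φ)) i) := rfl
  rw [h, combine_add, combine_add, combine_smul, combine_smul, combine_mul_left,
    combine_starMul hC hCv, combine_starMul hC hCv]

theorem combine_gauge_equation {C : Fin (N - 1) → Fin (N - 1) → Fin (N - 1) → ℝ}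
    {z : Fin (N - 1) → ℝ} {q c h : DiscSeries} {ℓ : ℝ} {f : Fin (N - 1) → DiscSeries}
    {G : DiscSeries}
    (hf : ∀ i, f i = eigenval i • (h * profileSeries z ℓ f i)
        + ℓ • gaugeRemainder v C z q c ℓ f G i) (j : ℕ) :
    combine v f j = h * combine v (eigenMul (profileSeries z ℓ f)) j
      + ℓ • (ℓ • (q ^ 2 * combine v (potentialSeries C ℓ (profileSeries z ℓ f)) j)
    + (2 : ℝ) • (avg 2 G * q * c ^ 3 * (X ^ 2 * combine v f j
      + combine v (eigenMul (profileSeries z ℓ f)) j))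
    - ((2 : ℝ) • (avg 2 G * q ^ 2 * c ^ 2 * ((3 : ℝ) • 1 - (2 : ℝ) • c ^ 2))
      - (ℓ / 2) • (pressureSeries v ℓ (profileSeries z ℓ f) * c ^ 3 * q ^ 3))
      * combine v (derivSeries z ℓ f) j) := by
  conv_lhs => rw [combine, Finset.sum_congr rfl fun i _ => by rw [hf i, gaugeRemainder]]
  simp only [combine, Finset.mul_sum, Finset.smul_sum, ← Finset.sum_add_distrib,
    ← Finset.sum_sub_distrib]
  refine Finset.sum_congr rfl fun i _ => ?_
  simp only [eigenMul, Algebra.smul_def]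
  ring

namespace DiscSeries

theorem hasDerivAt_ev_avg (p : ℕ) (f : DiscSeries) {t : ℝ} (ht : |t| < 2) (h0 : t ≠ 0) :
    HasDerivAt (avg p f).ev ((f.ev t - (p + 1) * (avg p f).ev t) / t) t := by
  have h := (hasDerivAt_pow_mul_ev_avg p f ht).fun_div (hasDerivAt_pow (p + 1) t)
    (pow_ne_zero _ h0)
  have heq : (avg p f).ev =ᶠ[𝓝 t] fun s => s ^ (p + 1) * (avg p f).ev s / s ^ (p + 1) := by
    filter_upwards [isOpen_ne.mem_nhds h0] with s hs
    rw [mul_div_cancel_left₀ _ (pow_ne_zero _ hs)]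
  refine (h.congr_of_eventuallyEq heq).congr_deriv ?_
  rw [Nat.add_sub_cancel]
  push_cast
  field_simp
  ring

theorem eventually_abs_le {t : ℝ} (ht : |t| < 2) : ∀ᶠ s in 𝓝 t, |s| ≤ 2 :=
  (continuous_abs.continuousAt.eventually_lt continuousAt_const ht).mono fun _ h => h.le

end DiscSeries

variable {N : ℕ} (v : Fin (N - 1) → Fin (N - 1) → ℝ) (z : Fin (N - 1) → ℝ) (ℓ : ℝ)
  (f : Fin (N - 1) → DiscSeries)

theorem ev_combine (φ : Fin (N - 1) → DiscSeries) (j : ℕ) {t : ℝ} (ht : |t| ≤ 2) :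
    (combine v φ j).ev t = ∑ i, extVec (v i) j * (t ^ (i : ℕ) * (φ i).ev t) := by
  simp only [combine, ← evHom_apply t ht, map_sum, map_smul, map_mul, map_pow, smul_eq_mul]
  simp [evHom_apply]

theorem ev_profileSeries (i : Fin (N - 1)) {t : ℝ} (ht : |t| ≤ 2) :
    (profileSeries z ℓ f i).ev t
      = z i * ℓ ^ (i : ℕ) + t ^ 2 * (avg 1 (slopeSeries f i)).ev t := by
  simp only [profileSeries, ← evHom_apply t ht, map_add, map_smul, map_mul, map_pow, map_one,
    smul_eq_mul]
  simp [evHom_apply]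

theorem ev_derivSeries (i : Fin (N - 1)) {t : ℝ} (ht : |t| ≤ 2) :
    (derivSeries z ℓ f i).ev t
      = ((i : ℝ) + 2) * (profileSeries z ℓ f i).ev t + t ^ 2 * (slopeSeries f i).ev t := by
  simp only [derivSeries, ← evHom_apply t ht, map_add, map_smul, map_mul, map_pow,
    smul_eq_mul]
  simp [evHom_apply]

theorem hasDerivAt_profileSeries (i : Fin (N - 1)) {t : ℝ} (ht : |t| < 2) :
    HasDerivAt (profileSeries z ℓ f i).ev (t * (slopeSeries f i).ev t) t := by
  have h := (hasDerivAt_pow_mul_ev_avg 1 (slopeSeries f i) ht).const_add (z i * ℓ ^ (i : ℕ))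
  rw [pow_one] at h
  exact h.congr_of_eventuallyEq ((eventually_abs_le ht).mono fun s hs =>
    ev_profileSeries z ℓ f i hs)

theorem hasDerivAt_field (j : ℕ) {t : ℝ} (ht : |t| < 2) :
    HasDerivAt (fun s => s ^ 2 * (combine v (profileSeries z ℓ f) j).ev s)
      (t * (combine v (derivSeries z ℓ f) j).ev t) t := by
  have h : HasDerivAt (fun s => ∑ i : Fin (N - 1),
      extVec (v i) j * (s ^ ((i : ℕ) + 2) * (profileSeries z ℓ f i).ev s))
      (∑ i : Fin (N - 1), extVec (v i) j * ((((i : ℕ) + 2 : ℕ) : ℝ) * t ^ ((i : ℕ) + 2 - 1)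
        * (profileSeries z ℓ f i).ev t + t ^ ((i : ℕ) + 2) * (t * (slopeSeries f i).ev t))) t :=
    HasDerivAt.fun_sum fun i _ => ((hasDerivAt_pow _ t).fun_mul
      (hasDerivAt_profileSeries z ℓ f i ht)).const_mul _
  refine (h.congr_of_eventuallyEq ((eventually_abs_le ht).mono fun s hs => ?_)).congr_deriv ?_
  · simp only
    rw [ev_combine v _ j hs, Finset.mul_sum]
    refine Finset.sum_congr rfl fun i _ => ?_
    ring
  · rw [ev_combine v _ j ht.le, Finset.mul_sum]
    refine Finset.sum_congr rfl fun i _ => ?_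
    rw [ev_derivSeries z ℓ f i ht.le]
    push_cast
    ring

theorem hasDerivAt_field_deriv (j : ℕ) {t : ℝ} (ht : |t| < 2) (h0 : t ≠ 0) :
    HasDerivAt (fun s => s * (combine v (derivSeries z ℓ f) j).ev s)
      ((combine v (eigenMul (profileSeries z ℓ f)) j).ev t + t ^ 2 * (combine v f j).ev t) t := by
  have h : HasDerivAt (fun s => ∑ i : Fin (N - 1),
      extVec (v i) j * (s ^ ((i : ℕ) + 1) * (((i : ℝ) + 2) * (profileSeries z ℓ f i).ev s
        + s ^ 2 * (slopeSeries f i).ev s))) _ t :=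
    HasDerivAt.fun_sum fun i _ => ((hasDerivAt_pow _ t).fun_mul
      (((hasDerivAt_profileSeries z ℓ f i ht).const_mul _).fun_add
        ((hasDerivAt_pow 2 t).fun_mul (hasDerivAt_ev_avg _ (f i) ht h0)))).const_mul _
  refine (h.congr_of_eventuallyEq ((eventually_abs_le ht).mono fun s hs => ?_)).congr_deriv ?_
  · simp only
    rw [ev_combine v _ j hs, Finset.mul_sum]
    refine Finset.sum_congr rfl fun i _ => ?_
    rw [ev_derivSeries z ℓ f i hs]
    ring
  · rw [ev_combine v _ j ht.le, ev_combine v _ j ht.le, Finset.mul_sum, ← Finset.sum_add_distrib]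
    refine Finset.sum_congr rfl fun i _ => ?_
    have he : (eigenMul (profileSeries z ℓ f) i).ev t
        = eigenval i * (profileSeries z ℓ f i).ev t := by
      simp only [eigenMul, ← evHom_apply t ht.le, map_smul, smul_eq_mul]
    rw [he, eigenval, show (avg (2 * ((i : ℕ) + 2)) (f i)).ev t = (slopeSeries f i).ev t from rfl,
      Nat.add_sub_cancel]
    push_cast
    field_simp
    ring

theorem ev_gauge_equation {v : Fin (N - 1) → Fin (N - 1) → ℝ} (hv : IsEigenBasis N v)
    {C : Fin (N - 1) → Fin (N - 1) → Fin (N - 1) → ℝ}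
    (hC : ∀ a b c : Fin (N - 1), (a : ℕ) + (b : ℕ) < (c : ℕ) → C a b c = 0)
    (hCv : ∀ a b j, extVec (v a) j * extVec (v b) j = ∑ c, C a b c * extVec (v c) j)
    {z : Fin (N - 1) → ℝ} {q c h : DiscSeries} {ℓ : ℝ} {f : Fin (N - 1) → DiscSeries}
    {G : DiscSeries}
    (hf : ∀ i, f i = eigenval i • (h * profileSeries z ℓ f i)
        + ℓ • gaugeRemainder v C z q c ℓ f G i) {j : ℕ} (hj : j ∈ Finset.Icc 1 (N - 1))
    {t : ℝ} (ht : |t| ≤ 2) (hq : h.ev t * t ^ 2 = q.ev t ^ 2 - 1)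
    {Y : ℕ → ℝ} (hY : ∀ j, (combine v (profileSeries z ℓ f) j).ev t = Y j) :
    (1 - 2 * ℓ * (avg 2 G).ev t * t ^ 2 * q.ev t * c.ev t ^ 3)
        * ((combine v (eigenMul (profileSeries z ℓ f)) j).ev t + t ^ 2 * (combine v f j).ev t)
      + t ^ 2 * (2 * ℓ * (avg 2 G).ev t * q.ev t ^ 2 * c.ev t ^ 2 * (3 - 2 * c.ev t ^ 2)
        - ℓ ^ 2 / 2 * (pressureSeries v ℓ (profileSeries z ℓ f)).ev t * c.ev t ^ 3 * q.ev t ^ 3)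
        * (combine v (derivSeries z ℓ f) j).ev t
      - q.ev t ^ 2 * (1 + ℓ ^ 2 * t ^ 2 * Y j)
        * (2 * weight N j * (Y j + ℓ ^ 2 / 2 * t ^ 2 * Y j ^ 2)
          - weight N (j + 1) * (Y (j + 1) + ℓ ^ 2 / 2 * t ^ 2 * Y (j + 1) ^ 2)
          - weight N (j - 1) * (Y (j - 1) + ℓ ^ 2 / 2 * t ^ 2 * Y (j - 1) ^ 2)) = 0 := by
  have e1 := congrArg (fun s => s.ev t) (combine_gauge_equation hf j)
  have e2 := congrArg (fun s => s.ev t) (combine_potentialSeries hC hCv ℓ (profileSeries z ℓ f) j)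
  have e3 := congrArg (fun s => s.ev t) (combine_eigenMul hv (profileSeries z ℓ f) hj)
  have e4 := congrArg (fun s => s.ev t)
    (combine_eigenMul hv (starMul C (profileSeries z ℓ f) (profileSeries z ℓ f)) hj)
  simp only [combine_starMul hC hCv] at e4
  simp only [← evHom_apply t ht, map_add, map_sub, map_mul, map_smul, map_pow, map_one,
    smul_eq_mul] at e1 e2 e3 e4
  simp only [evHom_apply, ev_X, hY] at e1 e2 e3 e4
  rw [e2, e4] at e1
  rw [e3] at e1 ⊢
  linear_combination t ^ 2 * e1 + (2 * weight N j * Y j - weight N (j + 1) * Y (j + 1)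
    - weight N (j - 1) * Y (j - 1)) * hq

theorem ev_pressureSeries (φ : Fin (N - 1) → DiscSeries) {t : ℝ} (ht : |t| ≤ 2) {Y : ℕ → ℝ}
    (hY : ∀ j, (combine v φ j).ev t = Y j) :
    (pressureSeries v ℓ φ).ev t = 4 * ∑ j ∈ Finset.Icc 1 N,
      (weight N j * (Y j + ℓ ^ 2 / 2 * (t ^ 2 * Y j ^ 2))
        - weight N (j - 1) * (Y (j - 1) + ℓ ^ 2 / 2 * (t ^ 2 * Y (j - 1) ^ 2))) ^ 2 := by
  simp only [pressureSeries, ← evHom_apply t ht, map_sum, map_add, map_sub, map_mul, map_smul,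
    map_pow, smul_eq_mul]
  simp only [evHom_apply, ev_X, hY]

theorem ev_kineticSeries (φ : Fin (N - 1) → DiscSeries) {t : ℝ} (ht : |t| ≤ 2) :
    (kineticSeries v φ).ev t
      = ∑ j ∈ Finset.Icc 1 (N - 1), weight N j * (combine v φ j).ev t ^ 2 := by
  simp only [kineticSeries, ← evHom_apply t ht, map_sum, map_smul, map_pow, smul_eq_mul]

theorem ev_massSource (q c G : DiscSeries) {t : ℝ} (ht : |t| ≤ 2) :
    (massSource v z q c ℓ f G).ev t
      = (1 - 2 * ℓ * (avg 2 G).ev t * t ^ 2 * q.ev t * c.ev t ^ 3)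
          * (kineticSeries v (derivSeries z ℓ f)).ev t
        + 1 / 4 * ((pressureSeries v ℓ (profileSeries z ℓ f)).ev t * q.ev t ^ 2) := by
  simp only [massSource, ← evHom_apply t ht, map_add, map_sub, map_smul, map_mul, map_pow,
    map_one, smul_eq_mul]
  simp only [evHom_apply, ev_X]
  ring

theorem abs_arctan_lt_two (x : ℝ) : |Real.arctan x| < 2 := by
  have h1 := Real.arctan_lt_pi_div_two x
  have h2 := Real.neg_pi_div_two_lt_arctan x
  have h3 := Real.pi_lt_four
  rw [abs_lt]
  constructor <;> linarith

theorem hasDerivAt_arctan_div (ℓ r : ℝ) :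
    HasDerivAt (fun x => Real.arctan (x / ℓ)) (Real.cos (Real.arctan (r / ℓ)) ^ 2 / ℓ) r := by
  refine ((hasDerivAt_id r).div_const ℓ).arctan.congr_deriv ?_
  rw [Real.cos_sq_arctan]
  simp
  ring

theorem weight_nonneg {N j : ℕ} (hj : j ≤ N) : 0 ≤ weight N j :=
  mul_nonneg (Nat.cast_nonneg j) (sub_nonneg.2 (Nat.cast_le.2 hj))

variable {N : ℕ} (v : Fin (N - 1) → Fin (N - 1) → ℝ) (z : Fin (N - 1) → ℝ) (ℓ : ℝ)
  (f : Fin (N - 1) → DiscSeries) (G q c : DiscSeries)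

/-- The mass function built from a solution of the rescaled equations. -/
def massFn (r : ℝ) : ℝ :=
  ℓ ^ 2 * (Real.arctan (r / ℓ) ^ 3 * (avg 2 G).ev (Real.arctan (r / ℓ)))

/-- The gauge field functions built from a solution of the rescaled equations. -/
def gaugeFn (j : ℕ) (r : ℝ) : ℝ :=
  Real.sqrt (weight N j) * (1 + ℓ ^ 2 * (Real.arctan (r / ℓ) ^ 2
    * (combine v (profileSeries z ℓ f) j).ev (Real.arctan (r / ℓ))))

/-- The logarithm of the lapse, up to a constant, in the compactified radius. -/
def logLapse (t : ℝ) : ℝ :=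
  t ^ 2 * (avg 1 ((2 * ℓ ^ 2) • (c ^ 3 * q * kineticSeries v (derivSeries z ℓ f)))).ev t

/-- The lapse function built from a solution of the rescaled equations. -/
def lapseFn (r : ℝ) : ℝ :=
  Real.exp (logLapse v z ℓ f q c (Real.arctan (r / ℓ)) - logLapse v z ℓ f q c (Real.pi / 2))

theorem hasDerivAt_massFn (r : ℝ) :
    HasDerivAt (massFn ℓ G) (ℓ ^ 2 * (Real.arctan (r / ℓ) ^ 2 * G.ev (Real.arctan (r / ℓ))
      * (Real.cos (Real.arctan (r / ℓ)) ^ 2 / ℓ))) r :=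
  ((hasDerivAt_pow_mul_ev_avg 2 G (abs_arctan_lt_two (r / ℓ))).comp r
    (hasDerivAt_arctan_div ℓ r)).const_mul (ℓ ^ 2)

theorem hasDerivAt_gaugeFn (j : ℕ) (r : ℝ) :
    HasDerivAt (gaugeFn v z ℓ f j) (Real.sqrt (weight N j) * (ℓ ^ 2 * (Real.arctan (r / ℓ)
      * (combine v (derivSeries z ℓ f) j).ev (Real.arctan (r / ℓ))
      * (Real.cos (Real.arctan (r / ℓ)) ^ 2 / ℓ)))) r :=
  ((((hasDerivAt_field v z ℓ f j (abs_arctan_lt_two (r / ℓ))).comp r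
    (hasDerivAt_arctan_div ℓ r)).const_mul (ℓ ^ 2)).const_add 1).const_mul _

theorem deriv_gaugeFn (j : ℕ) :
    deriv (gaugeFn v z ℓ f j) = fun r => Real.sqrt (weight N j) * (ℓ ^ 2 * (Real.arctan (r / ℓ)
      * (combine v (derivSeries z ℓ f) j).ev (Real.arctan (r / ℓ))
      * (Real.cos (Real.arctan (r / ℓ)) ^ 2 / ℓ))) :=
  funext fun r => (hasDerivAt_gaugeFn v z ℓ f j r).deriv

theorem hasDerivAt_deriv_gaugeFn (j : ℕ) {r : ℝ} (h0 : Real.arctan (r / ℓ) ≠ 0) :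
    HasDerivAt (deriv (gaugeFn v z ℓ f j)) (Real.sqrt (weight N j) * (ℓ ^ 2 *
      (((combine v (eigenMul (profileSeries z ℓ f)) j).ev (Real.arctan (r / ℓ))
        + Real.arctan (r / ℓ) ^ 2 * (combine v f j).ev (Real.arctan (r / ℓ)))
        * (Real.cos (Real.arctan (r / ℓ)) ^ 2 / ℓ) * (Real.cos (Real.arctan (r / ℓ)) ^ 2 / ℓ)
      + Real.arctan (r / ℓ) * (combine v (derivSeries z ℓ f) j).ev (Real.arctan (r / ℓ))
        * (2 * Real.cos (Real.arctan (r / ℓ)) * (-Real.sin (Real.arctan (r / ℓ))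
          * (Real.cos (Real.arctan (r / ℓ)) ^ 2 / ℓ)) / ℓ)))) r := by
  rw [deriv_gaugeFn]
  have h1 := (hasDerivAt_field_deriv v z ℓ f j (abs_arctan_lt_two (r / ℓ)) h0).comp r
    (hasDerivAt_arctan_div ℓ r)
  have h2 := ((hasDerivAt_arctan_div ℓ r).cos.fun_pow 2).div_const ℓ
  refine ((h1.fun_mul h2).const_mul (ℓ ^ 2)).const_mul (Real.sqrt (weight N j)) |>.congr_deriv ?_
  simp

theorem hasDerivAt_lapseFn (r : ℝ) :
    HasDerivAt (lapseFn v z ℓ f q c) (lapseFn v z ℓ f q c r * (Real.arctan (r / ℓ)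
      * (2 * ℓ ^ 2 * (c.ev (Real.arctan (r / ℓ)) ^ 3 * q.ev (Real.arctan (r / ℓ))
        * (kineticSeries v (derivSeries z ℓ f)).ev (Real.arctan (r / ℓ))))
      * (Real.cos (Real.arctan (r / ℓ)) ^ 2 / ℓ))) r := by
  have ht := abs_arctan_lt_two (r / ℓ)
  have h := (((hasDerivAt_pow_mul_ev_avg 1
    ((2 * ℓ ^ 2) • (c ^ 3 * q * kineticSeries v (derivSeries z ℓ f))) ht).comp r
    (hasDerivAt_arctan_div ℓ r)).sub_const (logLapse v z ℓ f q c (Real.pi / 2))).exp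
  refine h.congr_deriv ?_
  have he : ((2 * ℓ ^ 2) • (c ^ 3 * q * kineticSeries v (derivSeries z ℓ f))).ev
      (Real.arctan (r / ℓ)) = 2 * ℓ ^ 2 * (c.ev (Real.arctan (r / ℓ)) ^ 3
        * q.ev (Real.arctan (r / ℓ))
        * (kineticSeries v (derivSeries z ℓ f)).ev (Real.arctan (r / ℓ))) := by
    simp only [← evHom_apply _ ht.le, map_smul, map_mul, map_pow, smul_eq_mul]
  rw [he, pow_one]
  rfl

theorem gaugeFn_sq {j : ℕ} (hj : j ≤ N) (r : ℝ) :
    gaugeFn v z ℓ f j r ^ 2 = weight N j * (1 + ℓ ^ 2 * (Real.arctan (r / ℓ) ^ 2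
      * (combine v (profileSeries z ℓ f) j).ev (Real.arctan (r / ℓ)))) ^ 2 := by
  rw [gaugeFn, mul_pow, Real.sq_sqrt (weight_nonneg hj)]

theorem GF_gaugeFn (r : ℝ) :
    GF N (gaugeFn v z ℓ f) r = ℓ ^ 2 * Real.arctan (r / ℓ) ^ 2
      * Real.cos (Real.arctan (r / ℓ)) ^ 4
      * (kineticSeries v (derivSeries z ℓ f)).ev (Real.arctan (r / ℓ)) := by
  rw [GF, ev_kineticSeries v _ (abs_arctan_lt_two _).le, Finset.mul_sum]
  refine Finset.sum_congr rfl fun j hj => ?_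
  rw [Finset.mem_Icc] at hj
  rw [deriv_gaugeFn, mul_pow, Real.sq_sqrt (weight_nonneg (by omega))]
  rcases eq_or_ne ℓ 0 with rfl | h
  · simp
  · field_simp

theorem pTheta_gaugeFn (r : ℝ) :
    pTheta N (gaugeFn v z ℓ f) r = ℓ ^ 4 * Real.arctan (r / ℓ) ^ 4 / (4 * r ^ 4)
      * (pressureSeries v ℓ (profileSeries z ℓ f)).ev (Real.arctan (r / ℓ)) := by
  rw [pTheta, pThetaVal, ev_pressureSeries v ℓ _ (abs_arctan_lt_two _).le (fun _ => rfl),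
    Finset.mul_sum, Finset.mul_sum, Finset.mul_sum]
  refine Finset.sum_congr rfl fun j hj => ?_
  rw [Finset.mem_Icc] at hj
  rw [gaugeFn_sq v z ℓ f hj.2, gaugeFn_sq v z ℓ f (by omega : j - 1 ≤ N)]
  have hw : weight N j - weight N (j - 1) = N + 1 - 2 * j := by
    rw [weight, weight, Nat.cast_sub hj.1]
    push_cast
    ring
  obtain ⟨x, hx⟩ : ∃ x, weight N j = x := ⟨_, rfl⟩
  obtain ⟨y, hy⟩ : ∃ y, weight N (j - 1) = y := ⟨_, rfl⟩
  rw [hx, hy] at hw ⊢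
  have hN : (N : ℝ) = x - y - 1 + 2 * j := by linear_combination -hw
  rw [hN]
  ring

theorem WF_gaugeFn {j : ℕ} (hj : j ∈ Finset.Icc 1 (N - 1)) (r : ℝ) {Y : ℕ → ℝ}
    (hY : ∀ j, (combine v (profileSeries z ℓ f) j).ev (Real.arctan (r / ℓ)) = Y j) :
    WF (gaugeFn v z ℓ f) j r = -(ℓ ^ 2 * Real.arctan (r / ℓ) ^ 2
      * (2 * weight N j * (Y j + ℓ ^ 2 / 2 * Real.arctan (r / ℓ) ^ 2 * Y j ^ 2)
        - weight N (j + 1) * (Y (j + 1) + ℓ ^ 2 / 2 * Real.arctan (r / ℓ) ^ 2 * Y (j + 1) ^ 2)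
        - weight N (j - 1)
          * (Y (j - 1) + ℓ ^ 2 / 2 * Real.arctan (r / ℓ) ^ 2 * Y (j - 1) ^ 2))) := by
  rw [Finset.mem_Icc] at hj
  rw [WF, WVal, gaugeFn_sq v z ℓ f (by omega : j ≤ N), gaugeFn_sq v z ℓ f (by omega : j - 1 ≤ N),
    gaugeFn_sq v z ℓ f (by omega : j + 1 ≤ N), hY, hY, hY]
  have hw : 1 - weight N j + 1 / 2 * (weight N (j - 1) + weight N (j + 1)) = 0 := by
    rw [weight, weight, weight, Nat.cast_sub hj.1]
    push_cast
    ring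
  linear_combination hw

section Equations

variable {v z ℓ f G q c}

theorem eq_mul_sin_div_cos (hℓ : ℓ ≠ 0) (r : ℝ) :
    r = ℓ * Real.sin (Real.arctan (r / ℓ)) / Real.cos (Real.arctan (r / ℓ)) := by
  rw [mul_div_assoc, ← Real.tan_eq_sin_div_cos, Real.tan_arctan, mul_div_cancel₀ r hℓ]

theorem muF_massFn (hℓ : 0 < ℓ) {Λ : ℝ} (hΛ : Λ = -3 / ℓ ^ 2) {r : ℝ} (hr : 0 < r) {q₀ : ℝ}
    (hq : q₀ * Real.sin (Real.arctan (r / ℓ)) = Real.arctan (r / ℓ)) :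
    muF Λ (massFn ℓ G) r = (1 - 2 * ℓ * (avg 2 G).ev (Real.arctan (r / ℓ))
      * Real.arctan (r / ℓ) ^ 2 * q₀ * Real.cos (Real.arctan (r / ℓ)) ^ 3)
      / Real.cos (Real.arctan (r / ℓ)) ^ 2 := by
  have hreq := eq_mul_sin_div_cos hℓ.ne' r
  have ht := Real.arctan_pos.2 (div_pos hr hℓ)
  have hc := Real.cos_arctan_pos (r / ℓ)
  have hs : 0 < Real.sin (Real.arctan (r / ℓ)) :=
    Real.sin_pos_of_pos_of_lt_pi ht (by linarith [Real.arctan_lt_pi_div_two (r / ℓ), Real.pi_pos])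
  have hsc := Real.sin_sq_add_cos_sq (Real.arctan (r / ℓ))
  rw [muF, massFn, hΛ]
  generalize Real.arctan (r / ℓ) = t at *
  generalize Real.cos t = cs at *
  generalize Real.sin t = s at *
  generalize (avg 2 G).ev t = H at *
  subst hreq
  rw [← hq]
  field_simp
  linear_combination hsc

theorem EYM_of_scaled (hv : IsEigenBasis N v)
    {C : Fin (N - 1) → Fin (N - 1) → Fin (N - 1) → ℝ}
    (hC : ∀ a b c : Fin (N - 1), (a : ℕ) + (b : ℕ) < (c : ℕ) → C a b c = 0)
    (hCv : ∀ a b j, extVec (v a) j * extVec (v b) j = ∑ c, C a b c * extVec (v c) j)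
    {h : DiscSeries}
    (hf : ∀ i, f i = eigenval i • (h * profileSeries z ℓ f i)
        + ℓ • gaugeRemainder v C z q c ℓ f G i)
    (hG : G = ℓ • massSource v z q c ℓ f G)
    (hc : ∀ t, |t| ≤ 2 → c.ev t = Real.cos t)
    (hq : ∀ t, |t| ≤ 2 → q.ev t * Real.sin t = t ∧ h.ev t * t ^ 2 = q.ev t ^ 2 - 1)
    (hℓ : 0 < ℓ) {Λ : ℝ} (hΛ : Λ = -3 / ℓ ^ 2) {r : ℝ} (hr : 0 < r) :
    EYM N Λ (massFn ℓ G) (lapseFn v z ℓ f q c) (gaugeFn v z ℓ f) r := by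
  have h2 := (abs_arctan_lt_two (r / ℓ)).le
  have ht := Real.arctan_pos.2 (div_pos hr hℓ)
  obtain ⟨hq1, hq2⟩ := hq _ h2
  have hcev := hc _ h2
  have hcos := Real.cos_arctan_pos (r / ℓ)
  have hs : 0 < Real.sin (Real.arctan (r / ℓ)) :=
    Real.sin_pos_of_pos_of_lt_pi ht (by linarith [Real.arctan_lt_pi_div_two (r / ℓ), Real.pi_pos])
  have hsc := Real.sin_sq_add_cos_sq (Real.arctan (r / ℓ))
  have hreq := eq_mul_sin_div_cos hℓ.ne' r
  have hmu := muF_massFn (G := G) hℓ hΛ hr hq1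
  refine ⟨by simp [gaugeFn, weight], by simp [gaugeFn, weight], ?_, ?_, fun j hj => ?_⟩
  · refine (hasDerivAt_massFn ℓ G r).congr_deriv ?_
    have hGe : G.ev (Real.arctan (r / ℓ))
        = ℓ * (massSource v z q c ℓ f G).ev (Real.arctan (r / ℓ)) := by
      conv_lhs => rw [hG]
      simp only [← evHom_apply _ h2, map_smul, smul_eq_mul]
    rw [hGe, ev_massSource v z ℓ f q c G h2, hmu, GF_gaugeFn, pTheta_gaugeFn, hcev]
    generalize (kineticSeries v (derivSeries z ℓ f)).ev _ = T
    generalize (pressureSeries v ℓ (profileSeries z ℓ f)).ev _ = P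
    generalize (avg 2 G).ev _ = H
    generalize q.ev _ = q₀ at *
    generalize Real.arctan (r / ℓ) = t at *
    generalize Real.cos t = cs at *
    generalize Real.sin t = s at *
    subst hreq
    rw [← hq1]
    field_simp
  · refine (hasDerivAt_lapseFn v z ℓ f q c r).congr_deriv ?_
    rw [GF_gaugeFn, hcev]
    congr 1
    generalize (kineticSeries v (derivSeries z ℓ f)).ev _ = T
    generalize q.ev _ = q₀ at *
    generalize Real.arctan (r / ℓ) = t at *
    generalize Real.cos t = cs at *
    generalize Real.sin t = s at *
    subst hreq
    rw [← hq1]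
    field_simp
  · have hd := hasDerivAt_deriv_gaugeFn v z ℓ f j ht.ne'
    refine ⟨(hasDerivAt_gaugeFn v z ℓ f j r).differentiableAt, hd.differentiableAt, ?_⟩
    have he := ev_gauge_equation hv hC hCv hf hj h2 hq2 (fun _ => rfl)
    rw [hd.deriv, (hasDerivAt_gaugeFn v z ℓ f j r).deriv, hmu, pTheta_gaugeFn,
      WF_gaugeFn v z ℓ f hj r (fun _ => rfl), massFn, gaugeFn, hΛ]
    rw [hcev] at he
    generalize (pressureSeries v ℓ (profileSeries z ℓ f)).ev _ = P at *
    generalize (avg 2 G).ev _ = H at *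
    generalize q.ev _ = q₀ at *
    generalize (combine v (eigenMul (profileSeries z ℓ f)) j).ev _
      + _ * (combine v f j).ev _ = y₂ at *
    generalize (combine v (derivSeries z ℓ f) j).ev _ = B at *
    generalize (combine v (profileSeries z ℓ f) j).ev _ = Y at *
    generalize 2 * weight N j * (Y + ℓ ^ 2 / 2 * Real.arctan (r / ℓ) ^ 2 * Y ^ 2) - _ - _ = A at *
    generalize Real.sqrt (weight N j) = w at *
    generalize Real.arctan (r / ℓ) = t at *
    generalize Real.cos t = cs at *
    generalize Real.sin t = s at *
    have h3 : 3 - 2 * cs ^ 2 = 1 + 2 * s ^ 2 := by linear_combination (-2) * hsc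
    rw [h3] at he
    subst hreq
    rw [← hq1] at he ⊢
    field_simp
    linear_combination 4 * ℓ ^ 2 * cs * s ^ 2 * w * he

end Equations

open DiscSeries

variable {N : ℕ}

theorem DiscSeries.continuousAt_ev (f : DiscSeries) {t : ℝ} (ht : |t| < 2) :
    ContinuousAt f.ev t :=
  f.continuousOn_ev.continuousAt (Icc_mem_nhds (abs_lt.1 ht).1 (abs_lt.1 ht).2)

theorem abs_pi_div_two_lt_two : |Real.pi / 2| < 2 := by
  rw [abs_of_pos Real.pi_div_two_pos]
  linarith [Real.pi_lt_four]

theorem tendsto_arctan_div_atTop {ℓ : ℝ} (hℓ : 0 < ℓ) :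
    Tendsto (fun r => Real.arctan (r / ℓ)) atTop (𝓝 (Real.pi / 2)) :=
  (Real.tendsto_arctan_atTop.mono_right nhdsWithin_le_nhds).comp
    (tendsto_id.atTop_div_const hℓ)

theorem tendsto_pow_mul_ev_arctan {ℓ : ℝ} (hℓ : 0 < ℓ) (n : ℕ) (g : DiscSeries) :
    Tendsto (fun r => Real.arctan (r / ℓ) ^ n * g.ev (Real.arctan (r / ℓ))) atTop
      (𝓝 ((Real.pi / 2) ^ n * g.ev (Real.pi / 2))) :=
  ((tendsto_arctan_div_atTop hℓ).pow n).mul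
    ((g.continuousAt_ev abs_pi_div_two_lt_two).tendsto.comp (tendsto_arctan_div_atTop hℓ))

theorem BCInfinity_of_scaled (v : Fin (N - 1) → Fin (N - 1) → ℝ) (z : Fin (N - 1) → ℝ) {ℓ : ℝ}
    (f : Fin (N - 1) → DiscSeries) (G q c : DiscSeries) (hℓ : 0 < ℓ) :
    BCInfinity N (massFn ℓ G) (lapseFn v z ℓ f q c) (gaugeFn v z ℓ f) := by
  refine ⟨⟨_, (tendsto_pow_mul_ev_arctan hℓ 3 (avg 2 G)).const_mul (ℓ ^ 2)⟩, ?_, fun j _ =>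
    ⟨_, (((tendsto_pow_mul_ev_arctan hℓ 2 (combine v (profileSeries z ℓ f) j)).const_mul
      (ℓ ^ 2)).const_add 1).const_mul _⟩⟩
  have h := ((tendsto_pow_mul_ev_arctan hℓ 2
    (avg 1 ((2 * ℓ ^ 2) • (c ^ 3 * q * kineticSeries v (derivSeries z ℓ f))))).sub_const
      (logLapse v z ℓ f q c (Real.pi / 2))).rexp
  rwa [show (Real.pi / 2) ^ 2 * (avg 1 ((2 * ℓ ^ 2) • (c ^ 3 * q
    * kineticSeries v (derivSeries z ℓ f)))).ev (Real.pi / 2)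
      = logLapse v z ℓ f q c (Real.pi / 2) from rfl, sub_self, Real.exp_zero] at h

theorem Real.arctan_le_self {x : ℝ} (hx : 0 < x) : Real.arctan x ≤ x := by
  have h := Real.lt_tan (Real.arctan_pos.2 hx) (Real.arctan_lt_pi_div_two x)
  rw [Real.tan_arctan] at h
  exact h.le

theorem massFn_isBigO {ℓ : ℝ} (hℓ : 0 < ℓ) (G : DiscSeries) :
    massFn ℓ G =O[𝓝[>] (0 : ℝ)] fun r => r ^ 3 := by
  refine IsBigO.of_bound (ℓ ^ 2 * ((1 / ℓ) ^ 3 * ‖avg 2 G‖)) ?_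
  filter_upwards [self_mem_nhdsWithin] with r (hr : 0 < r)
  have h0 := div_pos hr hℓ
  have h1 := Real.arctan_pos.2 h0
  have h2 := abs_ev_le (avg 2 G) (abs_arctan_lt_two (r / ℓ)).le
  rw [massFn, Real.norm_eq_abs, Real.norm_eq_abs, abs_mul, abs_mul, abs_of_pos (pow_pos hr 3),
    abs_of_pos (pow_pos h1 3), abs_of_pos (pow_pos hℓ 2)]
  calc ℓ ^ 2 * (Real.arctan (r / ℓ) ^ 3 * |(avg 2 G).ev (Real.arctan (r / ℓ))|)
      ≤ ℓ ^ 2 * ((r / ℓ) ^ 3 * ‖avg 2 G‖) := by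
        gcongr
        exact Real.arctan_le_self h0
    _ = ℓ ^ 2 * ((1 / ℓ) ^ 3 * ‖avg 2 G‖) * r ^ 3 := by ring

theorem regularOrigin_of_scaled (v : Fin (N - 1) → Fin (N - 1) → ℝ) (z : Fin (N - 1) → ℝ)
    {ℓ : ℝ} (f : Fin (N - 1) → DiscSeries) (G q c : DiscSeries) (hℓ : 0 < ℓ) :
    RegularOrigin N v (massFn ℓ G) (lapseFn v z ℓ f q c) (gaugeFn v z ℓ f) z := by
  have hdiv : AnalyticAt ℝ (fun r : ℝ => r / ℓ) 0 := analyticAt_id.div_const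
  have harc : AnalyticAt ℝ Real.arctan 0 := Real.contDiff_arctan.contDiffAt.analyticAt
  have hslope : AnalyticAt ℝ (dslope Real.arctan 0) 0 := by
    obtain ⟨p, hp⟩ := harc
    exact ⟨_, hp.has_fpower_series_dslope_fslope⟩
  refine ⟨massFn_isBigO hℓ G, Real.exp_pos _, 1, one_pos, fun i r => (ℓ ^ (i : ℕ))⁻¹
    * dslope Real.arctan 0 (r / ℓ) ^ ((i : ℕ) + 2)
    * (profileSeries z ℓ f i).ev (Real.arctan (r / ℓ)), fun i => ⟨?_, ?_⟩, fun j r _ => ?_⟩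
  · exact (analyticAt_const.mul ((hslope.comp_of_eq hdiv (zero_div ℓ)).pow _)).mul
      ((analyticAt_ev _).comp_of_eq (harc.comp_of_eq hdiv (zero_div ℓ)) (by simp))
  · simp only [zero_div, Real.arctan_zero, dslope_same]
    rw [(Real.hasDerivAt_arctan 0).deriv, ev_profileSeries z ℓ f i (by simp)]
    field_simp
    ring
  · have hκ : Real.arctan (r / ℓ) = r / ℓ * dslope Real.arctan 0 (r / ℓ) := by
      simpa using (sub_smul_dslope Real.arctan 0 (r / ℓ)).symm
    have hw : weight N ((j : ℕ) + 1) = ((j : ℕ) + 1 : ℝ) * ((N : ℝ) - ((j : ℕ) + 1)) := by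
      rw [weight]
      push_cast
      rfl
    rw [gaugeFn, hw, ev_combine v _ _ (abs_arctan_lt_two _).le, Finset.mul_sum, Finset.mul_sum]
    congr 2
    refine Finset.sum_congr rfl fun i _ => ?_
    rw [extVec_succ]
    beta_reduce
    generalize (profileSeries z ℓ f i).ev (Real.arctan (r / ℓ)) = p
    rw [hκ, mul_pow, mul_pow, div_pow, div_pow]
    field_simp
    ring

theorem exists_norm_combine_le (v : Fin (N - 1) → Fin (N - 1) → ℝ) (z : Fin (N - 1) → ℝ) (K : ℝ)
    (j : ℕ) : ∃ M : ℝ, ∀ ℓ : ℝ, |ℓ| ≤ 1 → ∀ f : Fin (N - 1) → DiscSeries, ‖f‖ ≤ K →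
      ‖combine v (profileSeries z ℓ f) j‖ ≤ M := by
  refine ⟨∑ i : Fin (N - 1), |extVec (v i) j| * (‖X ^ (i : ℕ)‖ * (|z i| * ‖(1 : DiscSeries)‖
    + ‖X ^ 2‖ * (‖avg 1‖ * (‖avg (2 * ((i : ℕ) + 2))‖ * K)))), fun ℓ hℓ f hf => ?_⟩
  refine (norm_sum_le _ _).trans (Finset.sum_le_sum fun i _ => ?_)
  rw [norm_smul, Real.norm_eq_abs]
  refine mul_le_mul_of_nonneg_left ((norm_mul_le _ _).trans
    (mul_le_mul_of_nonneg_left ((norm_add_le _ _).trans (add_le_add ?_ ?_)) (norm_nonneg _)))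
    (abs_nonneg _)
  · rw [norm_smul, Real.norm_eq_abs, abs_mul, abs_pow]
    gcongr
    exact mul_le_of_le_one_right (abs_nonneg _) (pow_le_one₀ (abs_nonneg _) hℓ)
  · refine (norm_mul_le _ _).trans (mul_le_mul_of_nonneg_left ?_ (norm_nonneg _))
    refine ((avg 1).le_opNorm _).trans (mul_le_mul_of_nonneg_left ?_ (norm_nonneg _))
    refine ((avg _).le_opNorm _).trans (mul_le_mul_of_nonneg_left ?_ (norm_nonneg _))
    exact (norm_le_pi_norm f i).trans hf

theorem gaugeFn_ne_zero {v : Fin (N - 1) → Fin (N - 1) → ℝ} {z : Fin (N - 1) → ℝ} {ℓ : ℝ}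
    {f : Fin (N - 1) → DiscSeries} {j : ℕ} (hj : j ∈ Finset.Icc 1 (N - 1)) {M : ℝ}
    (hM : ‖combine v (profileSeries z ℓ f) j‖ ≤ M) (hℓ : ℓ ^ 2 * (4 * M) < 1) (r : ℝ) :
    gaugeFn v z ℓ f j r ≠ 0 := by
  rw [Finset.mem_Icc] at hj
  have hw : 0 < weight N j := by
    have h1 : (1 : ℝ) ≤ j := by exact_mod_cast hj.1
    have h2 : (j : ℝ) + 1 ≤ N := by exact_mod_cast (by omega : j + 1 ≤ N)
    exact mul_pos (by linarith) (by linarith)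
  have ht := abs_arctan_lt_two (r / ℓ)
  have h1 : Real.arctan (r / ℓ) ^ 2 ≤ 4 := by
    rw [← sq_abs]
    nlinarith [abs_nonneg (Real.arctan (r / ℓ))]
  have h2 := (abs_ev_le (combine v (profileSeries z ℓ f) j) ht.le).trans hM
  have h3 : |ℓ ^ 2 * (Real.arctan (r / ℓ) ^ 2
      * (combine v (profileSeries z ℓ f) j).ev (Real.arctan (r / ℓ)))| ≤ ℓ ^ 2 * (4 * M) := by
    rw [abs_mul, abs_mul, abs_of_nonneg (sq_nonneg _), abs_of_nonneg (sq_nonneg _)]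
    gcongr
  refine mul_ne_zero (Real.sqrt_pos.2 hw).ne' (ne_of_gt ?_)
  linarith [neg_abs_le (ℓ ^ 2 * (Real.arctan (r / ℓ) ^ 2
      * (combine v (profileSeries z ℓ f) j).ev (Real.arctan (r / ℓ))))]

theorem muF_massFn_pos {ℓ : ℝ} (hℓ : 0 < ℓ) {Λ : ℝ} (hΛ : Λ = -3 / ℓ ^ 2) {G q : DiscSeries}
    {K : ℝ} (hK : ‖G‖ ≤ K) (hsmall : ℓ * (8 * (‖avg 2‖ * K) * ‖q‖) < 1)
    (hq : ∀ t, |t| ≤ 2 → q.ev t * Real.sin t = t) {r : ℝ} (hr : 0 < r) :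
    0 < muF Λ (massFn ℓ G) r := by
  have ht := abs_arctan_lt_two (r / ℓ)
  rw [muF_massFn hℓ hΛ hr (hq _ ht.le)]
  refine div_pos (sub_pos.2 (lt_of_abs_lt (lt_of_le_of_lt ?_ hsmall)))
    (pow_pos (Real.cos_arctan_pos _) 2)
  have h1 : |Real.arctan (r / ℓ)| ^ 2 ≤ 4 := by nlinarith [abs_nonneg (Real.arctan (r / ℓ))]
  have h2 := abs_ev_le q ht.le
  have h3 : |(avg 2 G).ev (Real.arctan (r / ℓ))| ≤ ‖avg 2‖ * K :=
    (abs_ev_le _ ht.le).trans (((avg 2).le_opNorm G).trans (by gcongr))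
  have h4 : |Real.cos (Real.arctan (r / ℓ))| ^ 3 ≤ 1 :=
    pow_le_one₀ (abs_nonneg _) (Real.abs_cos_le_one _)
  rw [abs_mul, abs_mul, abs_mul, abs_mul, abs_mul, abs_pow, abs_pow, abs_two, abs_of_pos hℓ]
  calc 2 * ℓ * |(avg 2 G).ev (Real.arctan (r / ℓ))| * |Real.arctan (r / ℓ)| ^ 2
        * |q.ev (Real.arctan (r / ℓ))| * |Real.cos (Real.arctan (r / ℓ))| ^ 3
      ≤ 2 * ℓ * (‖avg 2‖ * K) * 4 * ‖q‖ * 1 := by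
        have : 0 ≤ ‖avg 2‖ * K := (abs_nonneg _).trans h3
        gcongr
    _ = ℓ * (8 * (‖avg 2‖ * K) * ‖q‖) := by ring

/-- **Nodeless solitons for sufficiently large |Λ|.** For fixed origin parameters
(z̄_2, …, z̄_N) ∈ ℝ^{N−1}, there is Λ₀ < 0 such that for every Λ < Λ₀ there is a
soliton solution of the su(N) EYM equations, regular at the origin with expansion
parameters (z̄_2, …, z̄_N), with μ > 0 on (0, ∞), satisfying the boundary conditions
at infinity, all of whose gauge field functions have no zeros on [0, ∞). -/
theorem nodeless_solitons_large_Lambda (N : ℕ) (hN : 2 ≤ N)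
    (v : Fin (N - 1) → Fin (N - 1) → ℝ) (hv : IsEigenBasis N v)
    (z : Fin (N - 1) → ℝ) :
    ∃ Λ₀ : ℝ, Λ₀ < 0 ∧ ∀ Λ : ℝ, Λ < Λ₀ →
      ∃ (m S : ℝ → ℝ) (ω : ℕ → ℝ → ℝ),
        RegularOrigin N v m S ω z ∧
        (∀ r : ℝ, 0 < r → 0 < muF Λ m r ∧ EYM N Λ m S ω r) ∧
        BCInfinity N m S ω ∧
        (∀ j ∈ Finset.Icc 1 (N - 1), ∀ r : ℝ, 0 ≤ r → ω j r ≠ 0) := by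
  obtain ⟨C, hC, hCv⟩ := hv.exists_structure_constants
  obtain ⟨c, hc⟩ := exists_ev_eq_cos
  obtain ⟨q, h, hq⟩ := exists_ev_inv_sinc
  obtain ⟨K, hK⟩ := exists_scaled_solution v C z q c h
  choose M hM using exists_norm_combine_le v z K
  have hsmall : ∀ᶠ ℓ : ℝ in 𝓝 0, ℓ * (8 * (‖avg 2‖ * K) * ‖q‖) < 1 :=
    ContinuousAt.eventually_lt (by fun_prop) continuousAt_const (by simp)
  have hgauge : ∀ᶠ ℓ : ℝ in 𝓝 0, ∀ j ∈ Finset.Icc 1 (N - 1), ℓ ^ 2 * (4 * M j) < 1 :=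
    (Filter.eventually_all_finset _).2 fun j _ =>
      ContinuousAt.eventually_lt (by fun_prop) continuousAt_const (by simp)
  have hone : ∀ᶠ ℓ : ℝ in 𝓝 0, |ℓ| < 1 :=
    ContinuousAt.eventually_lt (by fun_prop) continuousAt_const (by simp)
  obtain ⟨δ, hδ, hall⟩ := Metric.eventually_nhds_iff.1 (((hK.and hsmall).and hgauge).and hone)
  refine ⟨-3 / δ ^ 2, div_neg_of_neg_of_pos (by norm_num) (by positivity), fun Λ hΛ => ?_⟩
  have hΛ0 : Λ < 0 := hΛ.trans (div_neg_of_neg_of_pos (by norm_num) (by positivity))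
  have hpos : 0 < -3 / Λ := div_pos_of_neg_of_neg (by norm_num) hΛ0
  obtain ⟨ℓ, hℓ, hℓsq⟩ : ∃ ℓ : ℝ, 0 < ℓ ∧ ℓ ^ 2 = -3 / Λ :=
    ⟨_, Real.sqrt_pos.2 hpos, Real.sq_sqrt hpos.le⟩
  have hΛℓ : Λ = -3 / ℓ ^ 2 := by
    rw [hℓsq]
    field_simp
  have hℓδ : ℓ < δ := by
    rw [hΛℓ, div_lt_div_iff₀ (by positivity) (by positivity)] at hΛ
    exact lt_of_pow_lt_pow_left₀ 2 hδ.le (by linarith)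
  obtain ⟨⟨⟨⟨f, G, hfK, hGK, hf, hG⟩, hμ⟩, hj⟩, h1⟩ :=
    hall (y := ℓ) (by rwa [Real.dist_0_eq_abs, abs_of_pos hℓ])
  exact ⟨massFn ℓ G, lapseFn v z ℓ f q c, gaugeFn v z ℓ f,
    regularOrigin_of_scaled v z f G q c hℓ,
    fun r hr => ⟨muF_massFn_pos hℓ hΛℓ hGK hμ (fun t ht => (hq t ht).1) hr,
      EYM_of_scaled hv hC hCv hf hG hc hq hℓ hΛℓ hr⟩,
    BCInfinity_of_scaled v z f G q c hℓ,
    fun j hjm r _ => gaugeFn_ne_zero hjm (hM j ℓ h1.le f hfK) (hj j hjm) r⟩
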